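/- arXiv:1602.06443 — 3 statements merged into one kernel-verified Lean document; each statement's English description precedes it below -/
import Mathlib

section
/- Assume (λ_n, d_n)_{n∈ℤ} is a stationary and ergodic sequence under P and E_P(d_0) < ∞. Define Q by dQ/dP = d_0/E_P(d_0). Then: (a) the sequence (ẽ_n, ω̃_n)_{n∈ℤ} is stationary and ergodic under Q, i.e., its law on ({0,1}×(0,1))^ℤ is invariant under the shift and the shift is ergodic for it; (b) the law of the marked set 𝒜 under P equals the conditional law of 𝒜̃ under Q given the event {0 ∈ 𝒜̃}; equivalently, the law of the indicator sequence (e_n)_{n∈ℤ} = (1{n∈𝒜})_{n∈ℤ} under P equals the law of (ẽ_n)_{n∈ℤ} under Q conditioned on ẽ_0 = 1. -/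
open MeasureTheory ProbabilityTheory Filter Set
open scoped ENNReal NNReal Topology

noncomputable section

/-- One-step transition probability of the nearest-neighbour walk in environment `env`:
probability `env i` of a step from `i` to `i+1`, probability `1 - env i` of a step
from `i` to `i-1`. -/
def stepProb (env : ℤ → ℝ) (i j : ℤ) : ℝ :=
  if j = i + 1 then env i else if j = i - 1 then 1 - env i else 0

/-- `IsQuenchedRW env x μ` says that `μ` is the quenched law `P_{x,ω}` of the random walk
in the environment `env` started at `x`: a probability measure on trajectories whose
cylinder probabilities are products of the one-step transition probabilities. -/
def IsQuenchedRW (env : ℤ → ℝ) (x : ℤ) (μ : Measure (ℕ → ℤ)) : Prop :=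
  IsProbabilityMeasure μ ∧
  ∀ (n : ℕ) (path : ℕ → ℤ), path 0 = x →
    μ {f | ∀ k ≤ n, f k = path k}
      = ENNReal.ofReal (∏ k ∈ Finset.range n, stepProb env (path k) (path (k + 1)))

/-- The sparse environment: `lam k` at the marked site `a k`, and `1/2` elsewhere. -/
def sparseEnv (lam : ℤ → ℝ) (a : ℤ → ℤ) (n : ℤ) : ℝ :=
  haveI := Classical.propDecidable (∃ k, a k = n)
  if h : ∃ k, a k = n then lam h.choose else 1 / 2

/-- Indicator (valued in `{0,1} ⊆ ℕ`) that `n` is a marked site of the point set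
`{a_k + M : k ∈ ℤ}`. -/
def markInd (a : ℤ → ℤ) (M : ℤ) (n : ℤ) : ℕ :=
  haveI := Classical.propDecidable (∃ k, a k + M = n)
  if ∃ k, a k + M = n then 1 else 0

/-- Gap lengths read off a sequence, forced to be at least one. -/
def gapOf (f : ℤ → ℝ × ℕ) (k : ℤ) : ℕ := max (f k).2 1

/-- Positions of the marked sites. -/
def posn (f : ℤ → ℝ × ℕ) (k : ℤ) : ℤ :=
  (∑ i ∈ Finset.Ioc 0 k, (gapOf f i : ℤ)) - ∑ i ∈ Finset.Ioc k 0, (gapOf f i : ℤ)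

/-- The shifted marked environment. -/
def envOf (f : ℤ → ℝ × ℕ) (m : ℤ) : ℤ → ℕ × ℝ := fun n =>
  (markInd (posn f) m n, sparseEnv (fun k => (f k).1) (fun k => posn f k + m) n)

lemma one_le_gapOf (f : ℤ → ℝ × ℕ) (k : ℤ) : 1 ≤ gapOf f k := le_max_right _ _

lemma posn_zero (f : ℤ → ℝ × ℕ) : posn f 0 = 0 := by simp [posn]

lemma posn_rec (f : ℤ → ℝ × ℕ) (k : ℤ) : posn f k - posn f (k - 1) = gapOf f k := by
  unfold posn
  rcases lt_or_ge 0 k with hk | hk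
  · have h1 : Finset.Ioc 0 k = insert k (Finset.Ioc 0 (k - 1)) := by
      ext x; simp only [Finset.mem_Ioc, Finset.mem_insert]; omega
    have h2 : Finset.Ioc k 0 = ∅ := by
      ext x; simp only [Finset.mem_Ioc, Finset.notMem_empty, iff_false]; omega
    have h3 : Finset.Ioc (k - 1) 0 = ∅ := by
      ext x; simp only [Finset.mem_Ioc, Finset.notMem_empty, iff_false]; omega
    rw [h1, h2, h3, Finset.sum_insert (by simp)]
    simp
  · have h1 : Finset.Ioc (k - 1) 0 = insert k (Finset.Ioc k 0) := by
      ext x; simp only [Finset.mem_Ioc, Finset.mem_insert]; omega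
    have h2 : Finset.Ioc 0 k = ∅ := by
      ext x; simp only [Finset.mem_Ioc, Finset.notMem_empty, iff_false]; omega
    have h3 : Finset.Ioc 0 (k - 1) = ∅ := by
      ext x; simp only [Finset.mem_Ioc, Finset.notMem_empty, iff_false]; omega
    rw [h1, h2, h3, Finset.sum_insert (by simp)]
    simp

lemma eq_of_rec (a b : ℤ → ℤ) (h0 : a 0 = b 0)
    (h : ∀ k, a k - a (k - 1) = b k - b (k - 1)) (k : ℤ) : a k = b k := by
  induction k using Int.induction_on with
  | zero => exact h0
  | succ i ih =>
    have := h (i + 1)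
    rw [add_sub_cancel_right] at this
    omega
  | pred i ih =>
    have := h (-i)
    omega

lemma posn_strictMono (f : ℤ → ℝ × ℕ) : StrictMono (posn f) := by
  apply strictMono_int_of_lt_succ
  intro k
  have h := posn_rec f (k + 1)
  rw [add_sub_cancel_right] at h
  have := one_le_gapOf f (k + 1)
  omega

lemma posn_shift (f : ℤ → ℝ × ℕ) (k : ℤ) :
    posn (fun n => f (n + 1)) k = posn f (k + 1) - gapOf f 1 := by
  refine eq_of_rec (posn (fun n => f (n + 1))) (fun k => posn f (k + 1) - gapOf f 1) ?_ ?_ k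
  · have := posn_rec f 1
    rw [sub_self, posn_zero] at this
    simp only [posn_zero, zero_add]
    omega
  · intro k
    have h1 := posn_rec (fun n => f (n + 1)) k
    have h2 := posn_rec f (k + 1)
    rw [h1]
    have h3 : k - 1 + 1 = k := by omega
    simp only [add_sub_cancel_right, h3] at h2 ⊢
    have h4 : gapOf (fun n => f (n + 1)) k = gapOf f (k + 1) := rfl
    omega

lemma sparseEnv_mark (lam : ℤ → ℝ) (a : ℤ → ℤ) (ha : Function.Injective a) (k n : ℤ)
    (h : a k = n) : sparseEnv lam a n = lam k := by
  have hex : ∃ k, a k = n := ⟨k, h⟩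
  unfold sparseEnv
  rw [dif_pos hex]
  exact congrArg lam (ha (hex.choose_spec.trans h.symm))

lemma sparseEnv_unmark (lam : ℤ → ℝ) (a : ℤ → ℤ) (n : ℤ)
    (h : ¬ ∃ k, a k = n) : sparseEnv lam a n = 1 / 2 := by
  unfold sparseEnv
  rw [dif_neg h]

lemma posn_add_inj (f : ℤ → ℝ × ℕ) (m : ℤ) : Function.Injective (fun k => posn f k + m) := by
  intro i j h
  exact (posn_strictMono f).injective (by simpa using h)

lemma markInd_eq_one (a : ℤ → ℤ) (M n : ℤ) : markInd a M n = 1 ↔ ∃ k, a k + M = n := by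
  unfold markInd
  split_ifs with h <;> simp [h]

lemma markInd_congr {a b : ℤ → ℤ} {M N n n' : ℤ}
    (h : (∃ k, a k + M = n) ↔ ∃ k, b k + N = n') : markInd a M n = markInd b N n' := by
  by_cases h1 : ∃ k, a k + M = n
  · rw [(markInd_eq_one a M n).2 h1, (markInd_eq_one b N n').2 (h.1 h1)]
  · unfold markInd
    rw [if_neg h1, if_neg (fun h2 => h1 (h.2 h2))]

lemma envOf_succ (f : ℤ → ℝ × ℕ) (m n : ℤ) : envOf f m (n + 1) = envOf f (m - 1) n := by
  have hiff : ∀ k, posn f k + m = n + 1 ↔ posn f k + (m - 1) = n := fun k => by omega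
  unfold envOf
  refine Prod.ext ?_ ?_
  · exact markInd_congr (exists_congr hiff)
  · by_cases h : ∃ k, posn f k + m = n + 1
    · obtain ⟨k, hk⟩ := h
      exact (sparseEnv_mark (fun k => (f k).1) _ (posn_add_inj f m) k _ hk).trans
        (sparseEnv_mark (fun k => (f k).1) _ (posn_add_inj f (m - 1)) k n ((hiff k).1 hk)).symm
    · have h' : ¬ ∃ k, posn f k + (m - 1) = n := by rwa [← exists_congr hiff]
      exact (sparseEnv_unmark (fun k => (f k).1) _ _ h).trans
        (sparseEnv_unmark (fun k => (f k).1) _ _ h').symm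

lemma envOf_shift (f : ℤ → ℝ × ℕ) (m : ℤ) :
    envOf (fun n => f (n + 1)) m = envOf f (m - gapOf f 1) := by
  funext n
  have hiff : ∀ k, posn (fun n => f (n + 1)) k + m = n ↔
      posn f (k + 1) + (m - gapOf f 1) = n := fun k => by rw [posn_shift]; omega
  have hiff2 : (∃ k, posn (fun n => f (n + 1)) k + m = n) ↔
      ∃ k, posn f k + (m - gapOf f 1) = n := by
    constructor
    · rintro ⟨k, hk⟩
      exact ⟨k + 1, (hiff k).1 hk⟩
    · rintro ⟨k, hk⟩
      exact ⟨k - 1, (hiff (k - 1)).2 (by simpa using hk)⟩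
  unfold envOf
  refine Prod.ext (markInd_congr hiff2) ?_
  by_cases h : ∃ k, posn (fun n => f (n + 1)) k + m = n
  · obtain ⟨k, hk⟩ := h
    exact (sparseEnv_mark (fun k => (f (k + 1)).1) _ (posn_add_inj _ m) k _ hk).trans
      (sparseEnv_mark (fun k => (f k).1) _ (posn_add_inj f _) (k + 1) n ((hiff k).1 hk)).symm
  · have h' : ¬ ∃ k, posn f k + (m - gapOf f 1) = n := by rwa [← hiff2]
    exact (sparseEnv_unmark (fun k => (f (k + 1)).1) _ _ h).trans
      (sparseEnv_unmark (fun k => (f k).1) _ _ h').symm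

lemma measurable_gapOf (k : ℤ) : Measurable (fun f : ℤ → ℝ × ℕ => gapOf f k) := by
  unfold gapOf
  have h : Measurable (fun f : ℤ → ℝ × ℕ => (f k).2) := (measurable_pi_apply k).snd
  exact h.max measurable_const

lemma measurable_posn (k : ℤ) : Measurable (fun f : ℤ → ℝ × ℕ => posn f k) := by
  unfold posn
  have h : ∀ i, Measurable (fun f : ℤ → ℝ × ℕ => (gapOf f i : ℤ)) := fun i =>
    (measurable_of_countable (fun n : ℕ => (n : ℤ))).comp (measurable_gapOf i)
  exact (Finset.measurable_fun_sum _ fun i _ => h i).sub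
    (Finset.measurable_fun_sum _ fun i _ => h i)

lemma measurableSet_posn (m k n : ℤ) : MeasurableSet {f : ℤ → ℝ × ℕ | posn f k + m = n} :=
  measurableSet_eq_fun ((measurable_posn k).add_const m) measurable_const

lemma measurableSet_ex (m n : ℤ) : MeasurableSet {f : ℤ → ℝ × ℕ | ∃ k, posn f k + m = n} := by
  rw [Set.ofPred_exists]
  exact MeasurableSet.iUnion fun k => measurableSet_posn m k n

lemma measurable_mark (m n : ℤ) : Measurable (fun f : ℤ → ℝ × ℕ => markInd (posn f) m n) := by
  unfold markInd
  exact Measurable.ite (measurableSet_ex m n) measurable_const measurable_const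

lemma measurable_sparse (m n : ℤ) : Measurable (fun f : ℤ → ℝ × ℕ =>
    sparseEnv (fun k => (f k).1) (fun k => posn f k + m) n) := by
  intro s hs
  have : (fun f : ℤ → ℝ × ℕ => sparseEnv (fun k => (f k).1) (fun k => posn f k + m) n) ⁻¹' s
      = (⋃ k, {f : ℤ → ℝ × ℕ | posn f k + m = n} ∩ (fun f => (f k).1) ⁻¹' s) ∪
        ({f : ℤ → ℝ × ℕ | ∃ k, posn f k + m = n}ᶜ ∩ {_f | (1 / 2 : ℝ) ∈ s}) := by
    ext f
    by_cases h : ∃ k, posn f k + m = n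
    · obtain ⟨k, hk⟩ := h
      have e := sparseEnv_mark (fun k => (f k).1) _ (posn_add_inj f m) k n hk
      simp only [mem_preimage, e, mem_union, mem_iUnion, mem_inter_iff, mem_ofPred_eq,
        mem_compl_iff]
      constructor
      · intro h
        exact Or.inl ⟨k, hk, h⟩
      · rintro (⟨j, hj, h⟩ | ⟨h, -⟩)
        · have : j = k := posn_add_inj f m (hj.trans hk.symm)
          rwa [← this]
        · exact absurd ⟨k, hk⟩ h
    · have e := sparseEnv_unmark (fun k => (f k).1) (fun k => posn f k + m) n h
      simp only [mem_preimage, e, mem_union, mem_iUnion, mem_inter_iff, mem_ofPred_eq,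
        mem_compl_iff]
      constructor
      · intro h'
        exact Or.inr ⟨h, h'⟩
      · rintro (⟨j, hj, -⟩ | ⟨-, h'⟩)
        · exact absurd ⟨j, hj⟩ h
        · exact h'
  rw [this]
  refine (MeasurableSet.iUnion fun k => (measurableSet_posn m k n).inter ?_).union
    ((measurableSet_ex m n).compl.inter (MeasurableSet.const _))
  exact (measurable_pi_apply k).fst hs

lemma measurable_envOf (m : ℤ) : Measurable (fun f : ℤ → ℝ × ℕ => envOf f m) :=
  measurable_pi_lambda _ fun n => (measurable_mark m n).prodMk (measurable_sparse m n)

lemma measurable_envOf2 : Measurable (fun p : (ℤ → ℝ × ℕ) × ℤ => envOf p.1 p.2) :=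
  measurable_from_prod_countable_left fun m => measurable_envOf m

attribute [irreducible] posn gapOf

lemma mark_zero_iff (f : ℤ → ℝ × ℕ) (m : ℤ) (h0 : 0 ≤ m) (h1 : m < gapOf f 0) :
    markInd (posn f) m 0 = 1 ↔ m = 0 := by
  rw [markInd_eq_one]
  constructor
  · rintro ⟨k, hk⟩
    have hm := (posn_strictMono f)
    have hr := posn_rec f 0
    rw [posn_zero] at hr
    rcases lt_or_ge k 0 with h | h
    · have := hm.monotone (show k ≤ 0 - 1 by omega)
      omega
    · have := hm.monotone h
      rw [posn_zero] at this
      omega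
  · rintro rfl
    exact ⟨0, by simp [posn_zero]⟩

lemma lintegral_floor (n : ℕ) (hn : 1 ≤ n) (h : ℤ → ℝ≥0∞) :
    ∫⁻ u, (n : ℝ≥0∞) * h ⌊u * (n : ℝ)⌋ ∂(volume.restrict (Set.Icc (0 : ℝ) 1))
      = ∑ m ∈ Finset.range n, h (m : ℤ) := by
  have hn0 : (0 : ℝ) < n := by exact_mod_cast hn
  rw [← Measure.restrict_congr_set (Ico_ae_eq_Icc (μ := volume) (a := (0 : ℝ)) (b := 1))]
  have key : ∀ u ∈ Set.Ico (0 : ℝ) 1, (n : ℝ≥0∞) * h ⌊u * (n : ℝ)⌋ =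
      ∑ m ∈ Finset.range n,
        (Set.Ico ((m : ℝ) / n) ((m + 1 : ℝ) / n)).indicator (fun _ => (n : ℝ≥0∞) * h (m : ℤ)) u := by
    intro u hu
    have hmem : ∀ m : ℕ, u ∈ Set.Ico ((m : ℝ) / n) ((m + 1 : ℝ) / n) ↔ ⌊u * (n : ℝ)⌋ = (m : ℤ) := by
      intro m
      rw [Int.floor_eq_iff, Set.mem_Ico, div_le_iff₀ hn0, lt_div_iff₀ hn0]
      simp
    have hf0 : 0 ≤ ⌊u * (n : ℝ)⌋ := Int.floor_nonneg.2 (mul_nonneg hu.1 hn0.le)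
    have hf1 : ⌊u * (n : ℝ)⌋ < n := by
      rw [Int.floor_lt]
      push_cast
      nlinarith [hu.2]
    obtain ⟨j, hj⟩ := Int.eq_ofNat_of_zero_le hf0
    rw [Finset.sum_eq_single_of_mem j (Finset.mem_range.2 (by omega))]
    · rw [Set.indicator_of_mem ((hmem j).2 hj), hj]
    · intro b _ hb
      rw [Set.indicator_of_notMem]
      rw [hmem b]
      omega
  rw [setLIntegral_congr_fun measurableSet_Ico key,
    lintegral_finsetSum _ (fun m _ => measurable_const.indicator measurableSet_Ico)]
  refine Finset.sum_congr rfl fun m hm => ?_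
  rw [lintegral_indicator_const measurableSet_Ico, Measure.restrict_apply measurableSet_Ico,
    Set.inter_eq_left.2, Real.volume_Ico]
  · have : ((m + 1 : ℝ) / n - m / n) = (n : ℝ)⁻¹ := by field_simp; ring
    rw [this, ENNReal.ofReal_inv_of_pos hn0, ENNReal.ofReal_natCast, mul_right_comm,
      ENNReal.mul_inv_cancel (by simp; omega) (by simp), one_mul]
  · intro u hu
    have hm' : (m : ℝ) + 1 ≤ n := by exact_mod_cast Finset.mem_range.1 hm
    refine ⟨le_trans (by positivity) hu.1, lt_of_lt_of_le hu.2 ?_⟩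
    rwa [div_le_one hn0]

lemma measurable_sumRange {α : Type*} [MeasurableSpace α] (N : α → ℕ) (hN : Measurable N)
    (g : ℕ → α → ℝ≥0∞) (hg : ∀ m, Measurable (g m)) :
    Measurable (fun x => ∑ m ∈ Finset.range (N x), g m x) := by
  have : Measurable (fun p : α × ℕ => ∑ m ∈ Finset.range p.2, g m p.1) :=
    measurable_from_prod_countable_left fun n =>
      Finset.measurable_fun_sum (Finset.range n) fun m _ => hg m
  exact this.comp (measurable_id.prodMk hN)

/-- The basic formula for the law of (sequence, offset) under the size-biased measure. -/
lemma biased_apply {Ω : Type*} [MeasurableSpace Ω] (P : Measure Ω) [IsProbabilityMeasure P]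
    (F : Ω → ℤ → ℝ × ℕ) (hF : Measurable F) (U : Ω → ℝ) (hU : Measurable U)
    (hU_law : P.map U = volume.restrict (Set.Icc (0 : ℝ) 1)) (hind : IndepFun U F P)
    (c : ℝ≥0∞) (A : Set ((ℤ → ℝ × ℕ) × ℤ)) (hA : MeasurableSet A) :
    (P.withDensity (fun ω => (gapOf (F ω) 0 : ℝ≥0∞) / c))
      ((fun ω => (F ω, ⌊U ω * (gapOf (F ω) 0 : ℝ)⌋)) ⁻¹' A)
      = c⁻¹ * ∫⁻ f, ∑ m ∈ Finset.range (gapOf f 0), A.indicator 1 (f, (m : ℤ)) ∂(P.map F) := by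
  have hcast : Measurable (fun n : ℕ => (n : ℝ)) := measurable_of_countable _
  have hcast' : Measurable (fun n : ℕ => (n : ℝ≥0∞)) := measurable_of_countable _
  have hM : Measurable (fun p : ℝ × (ℤ → ℝ × ℕ) => (p.2, ⌊p.1 * (gapOf p.2 0 : ℝ)⌋)) :=
    measurable_snd.prodMk (Int.measurable_floor.comp (measurable_fst.mul
      (hcast.comp ((measurable_gapOf 0).comp measurable_snd))))
  have hUF : Measurable (fun ω => (U ω, F ω)) := hU.prodMk hF
  have hS : MeasurableSet ((fun ω => (F ω, ⌊U ω * (gapOf (F ω) 0 : ℝ)⌋)) ⁻¹' A) := hM.comp hUF hA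
  have hlaw : P.map (fun ω => (U ω, F ω)) =
      (volume.restrict (Set.Icc (0 : ℝ) 1)).prod (P.map F) := by
    rw [(indepFun_iff_map_prod_eq_prod_map_map hU.aemeasurable hF.aemeasurable).1 hind, hU_law]
  have hG : Measurable (fun p : ℝ × (ℤ → ℝ × ℕ) =>
      (gapOf p.2 0 : ℝ≥0∞) * A.indicator 1 (p.2, ⌊p.1 * (gapOf p.2 0 : ℝ)⌋)) :=
    (hcast'.comp ((measurable_gapOf 0).comp measurable_snd)).mul
      ((measurable_one.indicator hA).comp hM)
  have : IsProbabilityMeasure (P.map F) := Measure.isProbabilityMeasure_map hF.aemeasurable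
  calc _ = ∫⁻ ω, c⁻¹ * ((gapOf (F ω) 0 : ℝ≥0∞) *
          A.indicator 1 (F ω, ⌊U ω * (gapOf (F ω) 0 : ℝ)⌋)) ∂P := by
        rw [withDensity_apply _ hS, ← lintegral_indicator hS]
        refine lintegral_congr fun ω => ?_
        by_cases h : (F ω, ⌊U ω * (gapOf (F ω) 0 : ℝ)⌋) ∈ A
        · rw [Set.indicator_of_mem (by exact h), Set.indicator_of_mem h, div_eq_mul_inv]
          simp [mul_comm]
        · rw [Set.indicator_of_notMem (by exact h), Set.indicator_of_notMem h]
          simp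
    _ = c⁻¹ * ∫⁻ ω, ((gapOf (F ω) 0 : ℝ≥0∞) *
          A.indicator 1 (F ω, ⌊U ω * (gapOf (F ω) 0 : ℝ)⌋)) ∂P :=
        lintegral_const_mul _ (hG.comp hUF)
    _ = c⁻¹ * ∫⁻ p, ((gapOf p.2 0 : ℝ≥0∞) *
          A.indicator 1 (p.2, ⌊p.1 * (gapOf p.2 0 : ℝ)⌋)) ∂(P.map (fun ω => (U ω, F ω))) := by
        rw [lintegral_map hG hUF]
    _ = _ := by
        rw [hlaw, lintegral_prod_symm' _ hG]
        congr 1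
        refine lintegral_congr fun f => ?_
        exact lintegral_floor (gapOf f 0) (one_le_gapOf f 0) (fun m => A.indicator 1 (f, m))

lemma envOf_mem_iff {B : Set (ℤ → ℕ × ℝ)} (hB : (fun (g : ℤ → ℕ × ℝ) n => g (n + 1)) ⁻¹' B = B)
    (f : ℤ → ℝ × ℕ) (m : ℤ) : envOf f m ∈ B ↔ envOf f 0 ∈ B := by
  have step : ∀ m, envOf f m ∈ B ↔ envOf f (m - 1) ∈ B := by
    intro m
    have : envOf f (m - 1) = fun n => envOf f m (n + 1) := by
      funext n; rw [envOf_succ]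
    rw [this]
    conv_lhs => rw [← hB]
    rfl
  induction m using Int.induction_on with
  | zero => rfl
  | succ i ih => rw [step, add_sub_cancel_right]; exact ih
  | pred i ih => exact (step _).symm.trans ih

/-- Abstract form of part (a). -/
lemma ergodic_dual (μ : Measure (ℤ → ℝ × ℕ)) [IsProbabilityMeasure μ]
    (h_erg : Ergodic (fun f : ℤ → ℝ × ℕ => fun n => f (n + 1)) μ)
    (ν : Measure (ℤ → ℕ × ℝ)) (c : ℝ≥0∞)
    (hν : ∀ B, MeasurableSet B → ν B = c * ∫⁻ f, ∑ m ∈ Finset.range (gapOf f 0),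
      B.indicator 1 (envOf f (m : ℤ)) ∂μ) :
    Ergodic (fun f : ℤ → ℕ × ℝ => fun n => f (n + 1)) ν := by
  have hS : Measurable (fun f : ℤ → ℕ × ℝ => fun n : ℤ => f (n + 1)) :=
    measurable_pi_lambda _ fun n => measurable_pi_apply (n + 1)
  have hmeas : ∀ (B : Set (ℤ → ℕ × ℝ)), MeasurableSet B → ∀ m : ℤ,
      Measurable (fun f => (B.indicator 1 (envOf f m) : ℝ≥0∞)) := fun B hB m =>
    (measurable_one.indicator hB).comp (measurable_envOf m)
  have hpre : ∀ (B : Set (ℤ → ℕ × ℝ)) (f) (m : ℤ),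
      (((fun (g : ℤ → ℕ × ℝ) (n : ℤ) => g (n + 1)) ⁻¹' B).indicator 1 (envOf f m) : ℝ≥0∞)
        = B.indicator 1 (envOf f (m - 1)) := by
    intro B f m
    have : envOf f (m - 1) = fun n => envOf f m (n + 1) := by
      funext n; rw [envOf_succ]
    rw [this]
    rfl
  refine { measurable := hS, map_eq := ?_, aeconst_set := ?_ }
  · ext B hB
    rw [Measure.map_apply hS hB, hν _ (hS hB), hν _ hB]
    congr 1
    simp_rw [hpre B]
    -- split the sums
    have e1 : ∀ f : ℤ → ℝ × ℕ, ∑ m ∈ Finset.range (gapOf f 0),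
        (B.indicator 1 (envOf f ((m : ℤ) - 1)) : ℝ≥0∞) =
        ∑ m ∈ Finset.range (gapOf f 0 - 1), B.indicator 1 (envOf f (m : ℤ))
          + B.indicator 1 (envOf f (-1)) := by
      intro f
      obtain ⟨j, hj⟩ := Nat.exists_eq_add_of_le' (one_le_gapOf f 0)
      rw [hj, Finset.sum_range_succ']
      simp
    have e2 : ∀ f : ℤ → ℝ × ℕ, ∑ m ∈ Finset.range (gapOf f 0),
        (B.indicator 1 (envOf f (m : ℤ)) : ℝ≥0∞) =
        ∑ m ∈ Finset.range (gapOf f 0 - 1), B.indicator 1 (envOf f (m : ℤ))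
          + B.indicator 1 (envOf f ((gapOf f 0 : ℤ) - 1)) := by
      intro f
      obtain ⟨j, hj⟩ := Nat.exists_eq_add_of_le' (one_le_gapOf f 0)
      rw [hj, Finset.sum_range_succ]
      simp
    simp_rw [e1, e2]
    have hsum : Measurable (fun f : ℤ → ℝ × ℕ => ∑ m ∈ Finset.range (gapOf f 0 - 1),
        (B.indicator 1 (envOf f (m : ℤ)) : ℝ≥0∞)) :=
      measurable_sumRange _ ((measurable_of_countable (fun n : ℕ => n - 1)).comp
        (measurable_gapOf 0)) _ fun m => hmeas B hB m
    rw [lintegral_add_left hsum, lintegral_add_left hsum]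
    congr 1
    have hlast : Measurable (fun f : ℤ → ℝ × ℕ =>
        (B.indicator 1 (envOf f ((gapOf f 0 : ℤ) - 1)) : ℝ≥0∞)) :=
      ((measurable_one.indicator hB).comp measurable_envOf2).comp
        (measurable_id.prodMk ((measurable_of_countable (fun n : ℕ => (n : ℤ) - 1)).comp
          (measurable_gapOf 0)))
    rw [← h_erg.toMeasurePreserving.lintegral_comp hlast]
    refine lintegral_congr fun f => ?_
    rw [envOf_shift]
    have : gapOf (fun n => f (n + 1)) 0 = gapOf f 1 := by simp [gapOf]
    rw [this]
    congr 2
    omega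
  · intro B hB hinv
    have hC : MeasurableSet {f | envOf f 0 ∈ B} := measurable_envOf 0 hB
    have hCinv : (fun (f : ℤ → ℝ × ℕ) (n : ℤ) => f (n + 1)) ⁻¹' {f | envOf f 0 ∈ B}
        = {f | envOf f 0 ∈ B} := by
      ext f
      simp only [mem_preimage, mem_ofPred_eq]
      rw [envOf_shift, envOf_mem_iff hinv]
    have hc := h_erg.toPreErgodic.aeconst_set hC hCinv
    rw [eventuallyConst_set] at hc ⊢
    have hz : ∀ B' : Set (ℤ → ℕ × ℝ), MeasurableSet B' →
        (∀ᵐ f ∂μ, ∀ m : ℤ, envOf f m ∉ B') → ν B' = 0 := by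
      intro B' hB' h
      rw [hν B' hB', lintegral_congr_ae (g := fun _ => 0), lintegral_zero, mul_zero]
      filter_upwards [h] with f hf
      exact Finset.sum_eq_zero fun m _ => Set.indicator_of_notMem (hf m) _
    rcases hc with hc | hc
    · left
      change ν Bᶜ = 0
      apply hz _ hB.compl
      filter_upwards [hc] with f hf m
      rw [Set.notMem_compl_iff, envOf_mem_iff hinv]
      exact hf
    · right
      rw [← measure_eq_zero_iff_ae_notMem]
      apply hz _ hB
      filter_upwards [hc] with f hf m
      rw [envOf_mem_iff hinv]
      exact hf

/-- Theorem A / Palm duality: under `Q` with `dQ/dP = d_0/E_P(d_0)`,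
the randomly shifted marked environment is stationary and ergodic, and the law of the
marked set under `P` is the law of the shifted marked set under `Q` conditioned on
`0` being marked. -/
theorem statement10
    {Ω : Type*} [MeasurableSpace Ω] (P : Measure Ω) [IsProbabilityMeasure P]
    (lam : ℤ → Ω → ℝ) (d : ℤ → Ω → ℕ) (a : ℤ → Ω → ℤ)
    (hlam_meas : ∀ k, Measurable (lam k)) (hd_meas : ∀ k, Measurable (d k))
    (hlam01 : ∀ k, ∀ᵐ ω ∂P, lam k ω ∈ Set.Ioo (0 : ℝ) 1)
    (hd_pos : ∀ k ω, 1 ≤ d k ω)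
    (ha0 : ∀ ω, a 0 ω = 0)
    (ha_rec : ∀ ω, ∀ k : ℤ, a k ω - a (k - 1) ω = d k ω)
    -- stationarity and ergodicity of `(λ_n, d_n)` under `P`
    (h_erg : Ergodic (fun f : ℤ → ℝ × ℕ => fun n => f (n + 1))
      (P.map fun ω => fun n : ℤ => (lam n ω, d n ω)))
    -- `E_P (d_0) < ∞`
    (hd_int : ∫⁻ ω, (d 0 ω : ℝ≥0∞) ∂P ≠ ⊤)
    -- the auxiliary uniform random variable used to build the dual environment
    (U : Ω → ℝ) (hU_meas : Measurable U)
    (hU_law : P.map U = volume.restrict (Set.Icc (0 : ℝ) 1))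
    (hU_indep : IndepFun U (fun ω => fun k : ℤ => (lam k ω, d k ω)) P) :
    -- (a) `(ẽ_n, ω̃_n)_{n∈ℤ}` is stationary and ergodic under `Q`
    Ergodic (fun f : ℤ → ℕ × ℝ => fun n => f (n + 1))
      ((P.withDensity (fun ω => (d 0 ω : ℝ≥0∞) / ∫⁻ x, (d 0 x : ℝ≥0∞) ∂P)).map
        (fun ω => fun n : ℤ =>
          (markInd (fun k => a k ω) ⌊U ω * (d 0 ω : ℝ)⌋ n,
            sparseEnv (fun k => lam k ω)
              (fun k => a k ω + ⌊U ω * (d 0 ω : ℝ)⌋) n))) ∧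
    -- (b) `P(𝒜 ∈ ·) = Q(𝒜̃ ∈ · | 0 ∈ 𝒜̃)`
    P.map (fun ω => fun n : ℤ => markInd (fun k => a k ω) 0 n)
      = ((P.withDensity (fun ω => (d 0 ω : ℝ≥0∞) / ∫⁻ x, (d 0 x : ℝ≥0∞) ∂P))[|
          {ω | markInd (fun k => a k ω) ⌊U ω * (d 0 ω : ℝ)⌋ 0 = 1}]).map
        (fun ω => fun n : ℤ => markInd (fun k => a k ω) ⌊U ω * (d 0 ω : ℝ)⌋ n) := by
  set F : Ω → ℤ → ℝ × ℕ := fun ω n => (lam n ω, d n ω) with hFdef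
  have hF : Measurable F := measurable_pi_lambda _ fun n => (hlam_meas n).prodMk (hd_meas n)
  have hgap : ∀ ω k, gapOf (F ω) k = d k ω := fun ω k => by
    unfold gapOf; exact max_eq_left (hd_pos k ω)
  have hpos : ∀ ω k, a k ω = posn (F ω) k := fun ω k =>
    eq_of_rec (fun k => a k ω) (posn (F ω)) (by simp [ha0, posn_zero])
      (fun k => by rw [posn_rec, hgap]; exact ha_rec ω k) k
  set c : ℝ≥0∞ := ∫⁻ x, (d 0 x : ℝ≥0∞) ∂P with hc
  have hc1 : 1 ≤ c := by
    calc (1 : ℝ≥0∞) = ∫⁻ _, 1 ∂P := by simp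
      _ ≤ c := lintegral_mono (g := fun ω => (d 0 ω : ℝ≥0∞)) fun ω => by
        simpa using hd_pos 0 ω
  have hbase := biased_apply P F hF U hU_meas hU_law hU_indep c
  simp only [hgap] at hbase
  have hMmeas : Measurable (fun ω => (F ω, ⌊U ω * (d 0 ω : ℝ)⌋)) :=
    hF.prodMk (Int.measurable_floor.comp (hU_meas.mul
      ((measurable_of_countable (fun n : ℕ => (n : ℝ))).comp (hd_meas 0))))
  have : IsProbabilityMeasure (P.map F) := Measure.isProbabilityMeasure_map hF.aemeasurable
  simp only [hpos]
  constructor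
  · refine ergodic_dual (P.map F) h_erg _ c⁻¹ fun B hB => ?_
    have hm : Measurable (fun ω => envOf (F ω) ⌊U ω * (d 0 ω : ℝ)⌋) :=
      measurable_envOf2.comp hMmeas
    refine (Measure.map_apply hm hB).trans ?_
    exact hbase ((fun p : (ℤ → ℝ × ℕ) × ℤ => envOf p.1 p.2) ⁻¹' B) (measurable_envOf2 hB)
  · have hmark2 : Measurable (fun p : (ℤ → ℝ × ℕ) × ℤ => fun n : ℤ => markInd (posn p.1) p.2 n) :=
      measurable_from_prod_countable_left fun m =>
        measurable_pi_lambda _ fun n => measurable_mark m n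
    have hmark0 : Measurable (fun f : ℤ → ℝ × ℕ => fun n : ℤ => markInd (posn f) 0 n) :=
      measurable_pi_lambda _ fun n => measurable_mark 0 n
    have hE : MeasurableSet {p : (ℤ → ℝ × ℕ) × ℤ | markInd (posn p.1) p.2 0 = 1} :=
      ((measurable_pi_apply 0).comp hmark2) (measurableSet_singleton 1)
    have hEω : MeasurableSet {ω | markInd (posn (F ω)) ⌊U ω * (d 0 ω : ℝ)⌋ 0 = 1} :=
      hMmeas hE
    have main : ∀ s : Set (ℤ → ℕ), MeasurableSet s →
        (P.withDensity (fun ω => (d 0 ω : ℝ≥0∞) / c))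
          ({ω | markInd (posn (F ω)) ⌊U ω * (d 0 ω : ℝ)⌋ 0 = 1} ∩
            (fun ω => fun n : ℤ => markInd (posn (F ω)) ⌊U ω * (d 0 ω : ℝ)⌋ n) ⁻¹' s)
        = c⁻¹ * P ((fun ω => fun n : ℤ => markInd (posn (F ω)) 0 n) ⁻¹' s) := by
      intro s hs
      refine (hbase ({p : (ℤ → ℝ × ℕ) × ℤ | markInd (posn p.1) p.2 0 = 1} ∩
        (fun p : (ℤ → ℝ × ℕ) × ℤ => fun n : ℤ => markInd (posn p.1) p.2 n) ⁻¹' s)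
        (hE.inter (hmark2 hs))).trans ?_
      congr 1
      have hs0 := hmark0 hs
      have : P ((fun ω => fun n : ℤ => markInd (posn (F ω)) 0 n) ⁻¹' s) =
          ∫⁻ f, ((fun f : ℤ → ℝ × ℕ => fun n : ℤ => markInd (posn f) 0 n) ⁻¹' s).indicator 1 f
            ∂(P.map F) := by
        rw [lintegral_indicator_one hs0, Measure.map_apply hF hs0]
        rfl
      rw [this]
      refine lintegral_congr fun f => ?_
      rw [Finset.sum_eq_single_of_mem 0 (Finset.mem_range.2 (one_le_gapOf f 0))]
      · have h0 : markInd (posn f) 0 0 = 1 :=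
          (mark_zero_iff f 0 le_rfl (by exact_mod_cast one_le_gapOf f 0)).2 rfl
        by_cases h : (fun n : ℤ => markInd (posn f) 0 n) ∈ s
        · rw [Set.indicator_of_mem (by exact ⟨h0, h⟩), Set.indicator_of_mem (by exact h)]
          rfl
        · rw [Set.indicator_of_notMem (fun hh => h hh.2), Set.indicator_of_notMem (by exact h)]
      · intro m hm hm0
        refine Set.indicator_of_notMem (fun hh => hm0 ?_) _
        have := (mark_zero_iff f m (by positivity) (by exact_mod_cast Finset.mem_range.1 hm)).1 hh.1
        exact_mod_cast this
    ext s hs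
    have hm0 : Measurable (fun ω => fun n : ℤ => markInd (posn (F ω)) 0 n) := hmark0.comp hF
    have hm2 : Measurable (fun ω => fun n : ℤ =>
      markInd (posn (F ω)) ⌊U ω * (d 0 ω : ℝ)⌋ n) := hmark2.comp hMmeas
    rw [Measure.map_apply hm0 hs, Measure.map_apply hm2 hs, cond_apply hEω, main s hs]
    have hE1 := main Set.univ MeasurableSet.univ
    rw [Set.preimage_univ, Set.inter_univ, Set.preimage_univ, measure_univ, mul_one] at hE1
    rw [hE1, inv_inv, ← mul_assoc,
      ENNReal.mul_inv_cancel (one_pos.trans_le hc1).ne' hd_int, one_mul]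
end
end

section
/- Assume (d_n, λ_n)_{n∈ℤ} is stationary and ergodic under P, E_P(log ξ_0) exists, E_P(log d_0) < ∞, and in addition ℙ(limsup_{n→∞} X_n = +∞) = 1. Then the sequence (τ_n)_{n∈ℕ}, where τ_n = T_{a_n} − T_{a_{n−1}} (which is ℙ-a.s. finite), is stationary and ergodic under the annealed law ℙ: its joint law on ℕ^ℕ is invariant under the one-sided shift and the shift is ergodic for it. -/
open MeasureTheory ProbabilityTheory Filter Set
open scoped ENNReal NNReal Topology

noncomputable section

/-- `T_m = inf {k ≥ 0 : X_k = m}` as a natural number (`0` by convention if the walk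
never hits `m`; in the theorem below the relevant hitting times are a.s. finite). -/
def hitTimeN (f : ℕ → ℤ) (m : ℤ) : ℕ := sInf {k : ℕ | f k = m}

/-- Product law of the crossing times. -/
def prodLaw {E : Type*} [MeasurableSpace E] (T : E → E) (κ : Kernel E ℕ) (e : E) :
    Measure (ℕ → ℕ) := Measure.infinitePi (fun j : ℕ => κ (T^[j] e))

instance {E : Type*} [MeasurableSpace E] (T : E → E) (κ : Kernel E ℕ) [IsMarkovKernel κ] (e : E) :
    IsProbabilityMeasure (prodLaw T κ e) := by unfold prodLaw; infer_instance

lemma prodLaw_measurable {E : Type*} [MeasurableSpace E] {T : E → E} (hT : Measurable T)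
    (κ : Kernel E ℕ) [IsMarkovKernel κ] : Measurable (prodLaw T κ) := by
  refine Measurable.measure_of_isPiSystem_of_isProbabilityMeasure
    (S := squareCylinders (fun _ => {s | MeasurableSet s}))
    (generateFrom_squareCylinders (α := fun _ : ℕ => ℕ)).symm
    (isPiSystem_squareCylinders (fun i => MeasurableSpace.isPiSystem_measurableSet)
      (fun _ => by simp)) ?_
  rintro _ ⟨s, t, ht, rfl⟩
  unfold prodLaw
  have : ∀ e, Measure.infinitePi (fun j : ℕ => κ (T^[j] e)) (Set.pi s t)
      = ∏ i ∈ s, κ (T^[i] e) (t i) := fun e =>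
    Measure.infinitePi_pi _ (fun i _ => MeasurableSet.of_discrete)
  simp_rw [this]
  refine Finset.measurable_prod _ fun i _ => ?_
  exact (κ.measurable_coe MeasurableSet.of_discrete).comp (hT.iterate i)

def seqShift (s : ℕ → ℕ) : ℕ → ℕ := fun k => s (k + 1)

lemma seqShift_measurable : Measurable seqShift := by
  unfold seqShift; fun_prop

lemma prodLaw_shift {E : Type*} [MeasurableSpace E] (T : E → E) 
    (κ : Kernel E ℕ) [IsMarkovKernel κ] (e : E) :
    (prodLaw T κ e).map seqShift = prodLaw T κ (T e) := by
  refine Measure.eq_infinitePi _ fun s t ht => ?_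
  rw [Measure.map_apply seqShift_measurable (MeasurableSet.pi s.countable_toSet fun i _ => ht i)]
  have : seqShift ⁻¹' (Set.pi s t) =
      Set.pi (s.image (· + 1) : Finset ℕ) (fun i => t (i - 1)) := by
    ext x; simp [seqShift, Set.mem_pi]
  rw [this]
  unfold prodLaw
  rw [Measure.infinitePi_pi _ (fun i _ => ht _), Finset.prod_image (by simp)]
  simp

lemma prodLaw_zero_one {E : Type*} [MeasurableSpace E] (T : E → E) 
    (κ : Kernel E ℕ) [IsMarkovKernel κ] (e : E) (A : Set (ℕ → ℕ)) (hA : MeasurableSet A)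
    (hinv : seqShift ⁻¹' A = A) : prodLaw T κ e A = 0 ∨ prodLaw T κ e A = 1 := by
  have hind : iIndepFun (fun (i : ℕ) (x : ℕ → ℕ) => x i) (prodLaw T κ e) := by
    exact iIndepFun_infinitePi (P := fun j : ℕ => κ (T^[j] e)) (X := fun _ x => x)
      (fun _ => measurable_id)
  refine measure_zero_or_one_of_measurableSet_limsup_atTop
    (s := fun i : ℕ => MeasurableSpace.comap (fun x : ℕ → ℕ => x i) inferInstance) ?_ hind.iIndep ?_
  · intro n; exact (measurable_pi_apply n).comap_le
  · rw [limsup_eq_iInf_iSup_of_nat, MeasurableSpace.measurableSet_iInf]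
    intro n
    have hn : (seqShift^[n]) ⁻¹' A = A := by
      induction n with
      | zero => rfl
      | succ k ih => rw [Function.iterate_succ, Set.preimage_comp, ih, hinv]
    rw [← hn]
    have hval : ∀ n s k, seqShift^[n] s k = s (n + k) := by
      intro n
      induction n with
      | zero => simp
      | succ m ih => intro s k; rw [Function.iterate_succ_apply, ih]; simp [seqShift]; congr 1; ring
    refine @measurableSet_preimage _ _ (_) _ _ _ ?_ hA
    refine @measurable_pi_lambda _ _ _ (_) _ _ fun k => ?_
    simp_rw [hval]
    refine Measurable.mono (comap_measurable _) ?_ le_rfl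
    exact le_iSup₂_of_le (n + k) (Nat.le_add_right _ _) le_rfl

lemma ergodic_of_prodLaw {E : Type*} [MeasurableSpace E] {T : E → E} {Q : Measure E}
    [IsProbabilityMeasure Q] (hT : Ergodic T Q)
    (κ : Kernel E ℕ) [IsMarkovKernel κ] (μ : Measure (ℕ → ℕ)) 
    (hμ : ∀ A, MeasurableSet A → μ A = ∫⁻ e, prodLaw T κ e A ∂Q) :
    Ergodic seqShift μ := by
  have hm : ∀ A, MeasurableSet A → Measurable fun e => prodLaw T κ e A := fun A hA =>
    (Measure.measurable_coe hA).comp (prodLaw_measurable hT.measurable κ)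
  have hsh : ∀ e A, MeasurableSet A → prodLaw T κ e (seqShift ⁻¹' A) = prodLaw T κ (T e) A := by
    intro e A hA
    rw [← prodLaw_shift, Measure.map_apply seqShift_measurable hA]
  refine { measurable := seqShift_measurable, map_eq := ?_, aeconst_set := ?_ }
  · ext A hA
    rw [Measure.map_apply seqShift_measurable hA, hμ _ (seqShift_measurable hA), hμ _ hA]
    simp_rw [hsh _ _ hA]
    exact hT.toMeasurePreserving.lintegral_comp (hm A hA)
  · intro A hA hinv
    rw [eventuallyConst_set']
    have h01 := fun e => prodLaw_zero_one T κ e A hA hinv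
    have hB : MeasurableSet {e | prodLaw T κ e A = 1} := hm A hA (measurableSet_singleton 1)
    have hBi : T ⁻¹' {e | prodLaw T κ e A = 1} = {e | prodLaw T κ e A = 1} := by
      ext e; simp only [mem_preimage, mem_ofPred_eq]; rw [← hsh e A hA, hinv]
    rcases hT.toPreErgodic.ae_mem_or_ae_notMem hB hBi with h | h
    · right
      have : μ Aᶜ = 0 := by
        rw [hμ _ hA.compl, lintegral_eq_zero_iff (hm _ hA.compl)]
        filter_upwards [h] with e he
        simpa [prob_compl_eq_zero_iff hA] using he
      rw [ae_eq_univ]; exact this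
    · left
      rw [ae_eq_empty, hμ _ hA, lintegral_eq_zero_iff (hm _ hA)]
      filter_upwards [h] with e he
      exact (h01 e).resolve_right he

/-- identification of a product law from its cylinder probabilities. -/
lemma eq_prodLaw {E : Type*} [MeasurableSpace E] (T : E → E) 
    (κ : Kernel E ℕ) [IsMarkovKernel κ] (e : E) (ν : Measure (ℕ → ℕ))
    (h : ∀ (J : ℕ) (m : ℕ → ℕ), ν {s | ∀ j < J, s j = m j} 
      = ∏ j ∈ Finset.range J, κ (T^[j] e) {m j}) : ν = prodLaw T κ e := by
  refine (Measure.isProjectiveLimit_infinitePi (fun j : ℕ => κ (T^[j] e))).unique ?_ |>.symm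
  rw [isProjectiveLimit_nat_iff (isProjectiveMeasureFamily_pi (fun j : ℕ => κ (T^[j] e)))]
  intro n
  refine Measure.ext_of_singleton fun x => ?_
  rw [Measure.map_apply (by fun_prop) (measurableSet_singleton _), Measure.pi_singleton]
  let m : ℕ → ℕ := fun j => if hj : j ∈ Finset.Iic n then x ⟨j, hj⟩ else 0
  have h1 := h (n + 1) m
  have h2 : (Preorder.frestrictLe n ⁻¹' {x} : Set (ℕ → ℕ)) = {s | ∀ j < n + 1, s j = m j} := by
    ext s
    simp only [mem_preimage, mem_singleton_iff, mem_ofPred_eq, funext_iff, Subtype.forall, m]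
    constructor
    · intro hh j hj
      have hj' : j ∈ Finset.Iic n := by simp; omega
      rw [dif_pos hj']; exact hh j hj'
    · intro hh j hj
      have := hh j (by simp at hj; omega)
      rw [dif_pos hj] at this; exact this
  rw [h2, h1]
  have h3 : Finset.range (n + 1) = Finset.Iic n := by ext; simp
  rw [h3, ← Finset.prod_coe_sort]
  refine Finset.prod_congr rfl fun i _ => ?_
  simp only [m]
  rw [dif_pos i.2]

/-- Trajectories agreeing with `path` up to time `n`. -/
def cyl (n : ℕ) (path : ℕ → ℤ) : Set (ℕ → ℤ) := {f | ∀ k ≤ n, f k = path k}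

/-- Trajectories whose first visit to `y` at or after time `n` happens at time `N`. -/
def firstHit (n N : ℕ) (y : ℤ) : Set (ℕ → ℤ) := {f | f N = y ∧ ∀ k, n ≤ k → k < N → f k ≠ y}

lemma cyl_meas (n : ℕ) (path : ℕ → ℤ) : MeasurableSet (cyl n path) := by
  have : cyl n path = ⋂ k, ⋂ (_ : k ≤ n), (fun f : ℕ → ℤ => f k) ⁻¹' {path k} := by
    ext f; simp [cyl]
  rw [this]
  exact MeasurableSet.iInter fun k => MeasurableSet.iInter fun _ =>
    measurable_pi_apply k MeasurableSet.of_discrete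

lemma firstHit_meas (n N : ℕ) (y : ℤ) : MeasurableSet (firstHit n N y) := by
  have : firstHit n N y = (fun f : ℕ → ℤ => f N) ⁻¹' {y} ∩
      ⋂ k, ⋂ (_ : n ≤ k), ⋂ (_ : k < N), (fun f : ℕ → ℤ => f k) ⁻¹' {y}ᶜ := by
    ext f; simp [firstHit]
  rw [this]
  exact (measurable_pi_apply N MeasurableSet.of_discrete).inter (
    MeasurableSet.iInter fun k => MeasurableSet.iInter fun _ => MeasurableSet.iInter fun _ =>
    measurable_pi_apply k MeasurableSet.of_discrete)

/-- Probability that the walk started at `x` first hits `y` at time `m`. -/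
def hitW (env : ℤ → ℝ) (y : ℤ) : ℕ → ℤ → ℝ≥0∞
  | 0, x => if x = y then 1 else 0
  | m + 1, x => if x = y then 0 else
      ENNReal.ofReal (env x) * hitW env y m (x + 1) +
      ENNReal.ofReal (1 - env x) * hitW env y m (x - 1)

lemma hitW_shift (env : ℤ → ℝ) (y c : ℤ) (m : ℕ) (x : ℤ) :
    hitW (fun z => env (z + c)) y m x = hitW env (y + c) m (x + c) := by
  induction m generalizing x with
  | zero => simp [hitW]
  | succ m ih =>
    simp only [hitW, ih, add_left_inj]
    rw [show x + 1 + c = x + c + 1 by ring, show x - 1 + c = x + c - 1 by ring]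

section walk
variable {env : ℤ → ℝ} {μ : Measure (ℕ → ℤ)}

lemma walk_start (h : IsQuenchedRW env 0 μ) : ∀ᵐ f ∂μ, f 0 = 0 := by
  have := h.1
  have h2 := h.2 0 (fun _ => 0) rfl
  have hm : MeasurableSet {f : ℕ → ℤ | ∀ k ≤ 0, f k = 0} := cyl_meas 0 (fun _ => 0)
  simp only [Finset.range_zero, Finset.prod_empty, ENNReal.ofReal_one] at h2
  have h3 := (prob_compl_eq_zero_iff hm).2 h2
  have h4 : ∀ᵐ f ∂μ, f ∈ {f : ℕ → ℤ | ∀ k ≤ 0, f k = 0} := h3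
  filter_upwards [h4] with f hf using hf 0 le_rfl

lemma walk_step (h : IsQuenchedRW env 0 μ) :
    ∀ᵐ f ∂μ, ∀ n, f (n + 1) = f n + 1 ∨ f (n + 1) = f n - 1 := by
  rw [ae_all_iff]
  intro n
  have key : ∀ q : Fin (n + 2) → ℤ, ∀ᵐ f ∂μ, (∀ i : Fin (n + 2), f i = q i) → f 0 = 0 →
      f (n + 1) = f n + 1 ∨ f (n + 1) = f n - 1 := by
    intro q
    let path : ℕ → ℤ := fun k => if hk : k < n + 2 then q ⟨k, hk⟩ else 0
    by_cases h0 : path 0 = 0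
    · by_cases hs : path (n + 1) = path n + 1 ∨ path (n + 1) = path n - 1
      · refine ae_of_all _ fun f hf _ => ?_
        have e1 : f (n + 1) = path (n + 1) := by
          simp only [path]; rw [dif_pos (by omega)]; exact hf ⟨n + 1, by omega⟩
        have e2 : f n = path n := by
          simp only [path]; rw [dif_pos (by omega)]; exact hf ⟨n, by omega⟩
        rw [e1, e2]; exact hs
      · have h2 := h.2 (n + 1) path h0
        push Not at hs
        rw [Finset.prod_range_succ] at h2
        have : stepProb env (path n) (path (n + 1)) = 0 := by
          unfold stepProb; rw [if_neg hs.1, if_neg hs.2]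
        rw [this, mul_zero, ENNReal.ofReal_zero] at h2
        have h4 : ∀ᵐ f ∂μ, f ∉ {f : ℕ → ℤ | ∀ k ≤ n + 1, f k = path k} := 
          measure_eq_zero_iff_ae_notMem.1 h2
        filter_upwards [h4] with f hf hq
        refine absurd ?_ hf
        intro k hk
        simp only [path]; rw [dif_pos (by omega)]; exact hq ⟨k, by omega⟩
    · refine ae_of_all _ fun f hf hf0 => absurd ?_ h0
      simp only [path]; rw [dif_pos (by omega), ← hf0]; exact (hf ⟨0, by omega⟩).symm
  filter_upwards [ae_all_iff.2 key, walk_start h] with f hf h0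
  exact hf (fun i => f i) (fun _ => rfl) h0

lemma walk_cyl_succ (h : IsQuenchedRW env 0 μ) (henv : ∀ x, 0 ≤ env x ∧ env x ≤ 1)
    (n : ℕ) (path : ℕ → ℤ) (h0 : path 0 = 0) (z : ℤ) :
    μ (cyl (n + 1) (Function.update path (n + 1) z)) =
      μ (cyl n path) * ENNReal.ofReal (stepProb env (path n) z) := by
  unfold cyl
  rw [h.2 (n + 1) _ (by simp [Function.update, h0]), h.2 n path h0, Finset.prod_range_succ]
  have hnn : ∀ i j, 0 ≤ stepProb env i j := by
    intro i j; unfold stepProb; split_ifs <;> linarith [henv i]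
  have : ∏ k ∈ Finset.range n, stepProb env (Function.update path (n + 1) z k)
      (Function.update path (n + 1) z (k + 1)) =
      ∏ k ∈ Finset.range n, stepProb env (path k) (path (k + 1)) := by
    refine Finset.prod_congr rfl fun k hk => ?_
    have := Finset.mem_range.1 hk
    rw [Function.update_of_ne (by omega), Function.update_of_ne (by omega)]
  rw [this, Function.update_self, Function.update_of_ne (by omega), 
    ENNReal.ofReal_mul (Finset.prod_nonneg fun _ _ => hnn _ _)]

lemma walk_core (h : IsQuenchedRW env 0 μ) (henv : ∀ x, 0 ≤ env x ∧ env x ≤ 1)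
    (B : Set (ℕ → ℤ)) (hBm : MeasurableSet B) (c : ℝ≥0∞) (N : ℕ) (y : ℤ)
    (hB : ∀ path : ℕ → ℤ, path 0 = 0 → path N = y → μ (cyl N path ∩ B) = μ (cyl N path) * c) :
    ∀ m n, n + m = N → ∀ path : ℕ → ℤ, path 0 = 0 →
      μ (cyl n path ∩ (firstHit n N y ∩ B)) = μ (cyl n path) * (hitW env y m (path n) * c) := by
  intro m
  induction m with
  | zero =>
    rintro n rfl path h0
    simp only [add_zero] at *
    by_cases hy : path n = y
    · have : cyl n path ∩ (firstHit n n y ∩ B) = cyl n path ∩ B := by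
        ext f
        simp only [cyl, firstHit, mem_inter_iff, mem_ofPred_eq]
        constructor
        · rintro ⟨h1, _, h3⟩; exact ⟨h1, h3⟩
        · rintro ⟨h1, h3⟩
          exact ⟨h1, ⟨by rw [h1 n le_rfl, hy], fun k _ _ => by omega⟩, h3⟩
      rw [this, hB path h0 hy]; simp [hitW, hy]
    · have : cyl n path ∩ (firstHit n n y ∩ B) = ∅ := by
        ext f
        simp only [cyl, firstHit, mem_inter_iff, mem_ofPred_eq, mem_empty_iff_false, iff_false]
        rintro ⟨h1, h2, h3⟩
        exact hy (by rw [← h1 n le_rfl, h2.1])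
      rw [this]; simp [hitW, hy]
  | succ m ih =>
    intro n hn path h0
    by_cases hy : path n = y
    · have : cyl n path ∩ (firstHit n N y ∩ B) = ∅ := by
        ext f
        simp only [cyl, firstHit, mem_inter_iff, mem_ofPred_eq, mem_empty_iff_false, iff_false]
        rintro ⟨h1, h2, h3⟩
        exact h2.2 n le_rfl (by omega) (by rw [h1 n le_rfl, hy])
      rw [this]; simp [hitW, hy]
    · let U : ℤ → Set (ℕ → ℤ) := fun z =>
        cyl (n + 1) (Function.update path (n + 1) z) ∩ (firstHit (n + 1) N y ∩ B)
      have hU : ∀ z, μ (U z) = μ (cyl n path) * ENNReal.ofReal (stepProb env (path n) z) *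
          (hitW env y m z * c) := by
        intro z
        have := ih (n + 1) (by omega) (Function.update path (n + 1) z) 
          (by simp [Function.update, h0])
        rw [walk_cyl_succ h henv n path h0, Function.update_self] at this
        exact this
      have hUm : ∀ z, MeasurableSet (U z) := fun z =>
        (cyl_meas _ _).inter ((firstHit_meas _ _ _).inter hBm)
      have hmem : ∀ z f, f ∈ U z ↔ f ∈ cyl n path ∩ (firstHit n N y ∩ B) ∧ f (n + 1) = z := by
        intro z f
        simp only [U, cyl, firstHit, mem_inter_iff, mem_ofPred_eq]
        constructor
        · rintro ⟨h1, h2, h3⟩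
          have h1' : ∀ k ≤ n, f k = path k := fun k hk => by
            have := h1 k (by omega); rwa [Function.update_of_ne (by omega)] at this
          refine ⟨⟨h1', ⟨h2.1, fun k hk hk2 => ?_⟩, h3⟩, by simpa using h1 (n + 1) le_rfl⟩
          rcases hk.eq_or_lt with rfl | hlt
          · rw [h1' _ le_rfl]; exact hy
          · exact h2.2 k hlt hk2
        · rintro ⟨⟨h1, h2, h3⟩, h4⟩
          refine ⟨fun k hk => ?_, ⟨h2.1, fun k hk => h2.2 k (by omega)⟩, h3⟩
          rcases hk.eq_or_lt with rfl | hlt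
          · simpa using h4
          · rw [Function.update_of_ne (by omega)]; exact h1 k (by omega)
      have hae : (cyl n path ∩ (firstHit n N y ∩ B) : Set (ℕ → ℤ)) =ᵐ[μ]
          (U (path n + 1) ∪ U (path n - 1) : Set (ℕ → ℤ)) := by
        refine Filter.eventuallyEq_set.2 ?_
        filter_upwards [walk_step h] with f hf
        rw [mem_union, hmem, hmem]
        constructor
        · intro hh
          have := hh.1 n le_rfl
          rw [← this]
          exact (hf n).imp (fun x => ⟨hh, x⟩) (fun x => ⟨hh, x⟩)
        · rintro (hh | hh) <;> exact hh.1
      have hdis : Disjoint (U (path n + 1)) (U (path n - 1)) := by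
        rw [Set.disjoint_left]
        intro f h1 h2
        rw [hmem] at h1 h2
        have := h1.2.symm.trans h2.2
        omega
      rw [measure_congr hae, measure_union hdis (hUm _), hU, hU]
      have e1 : stepProb env (path n) (path n + 1) = env (path n) := by simp [stepProb]
      have e2 : stepProb env (path n) (path n - 1) = 1 - env (path n) := by
        unfold stepProb; rw [if_neg (by omega), if_pos rfl]
      rw [e1, e2]
      simp only [hitW, if_neg hy]
      ring

/-- Joint law of the successive crossing times. -/
lemma walk_joint (h : IsQuenchedRW env 0 μ) (henv : ∀ x, 0 ≤ env x ∧ env x ≤ 1)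
    (a : ℕ → ℤ) (ha : a 0 = 0) (m : ℕ → ℕ) (J : ℕ) :
    μ {f | ∀ j < J, f ∈ firstHit (∑ i ∈ Finset.range j, m i)
      (∑ i ∈ Finset.range (j + 1), m i) (a (j + 1))} =
      ∏ j ∈ Finset.range J, hitW env (a (j + 1)) (m j) (a j) := by
  set S : ℕ → ℕ := fun j => ∑ i ∈ Finset.range j, m i with hS
  let B : ℕ → Set (ℕ → ℤ) := fun i => {f | ∀ j, i ≤ j → j < J → f ∈ firstHit (S j) (S (j + 1)) (a (j + 1))}
  have hBm : ∀ i, MeasurableSet (B i) := by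
    intro i
    have : B i = ⋂ j, ⋂ (_ : i ≤ j), ⋂ (_ : j < J), firstHit (S j) (S (j + 1)) (a (j + 1)) := by
      ext f; simp [B]
    rw [this]
    exact MeasurableSet.iInter fun k => MeasurableSet.iInter fun _ => MeasurableSet.iInter fun _ =>
      firstHit_meas _ _ _
  have key : ∀ l i, i + l = J → ∀ path : ℕ → ℤ, path 0 = 0 → path (S i) = a i →
      μ (cyl (S i) path ∩ B i) = μ (cyl (S i) path) *
        ∏ j ∈ Finset.Ico i J, hitW env (a (j + 1)) (m j) (a j) := by
    intro l
    induction l with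
    | zero =>
      rintro i rfl path h0 hp
      have : B i = univ := by
        ext f; simp only [B, mem_ofPred_eq, mem_univ, iff_true]; intro j h1 h2; omega
      simp only [add_zero] at *
      simp [this]
    | succ l ih =>
      intro i hi path h0 hp
      have hBi : B i = firstHit (S i) (S (i + 1)) (a (i + 1)) ∩ B (i + 1) := by
        ext f; simp only [B, mem_ofPred_eq, mem_inter_iff]
        constructor
        · intro hf; exact ⟨hf i le_rfl (by omega), fun j hj hj2 => hf j (by omega) hj2⟩
        · rintro ⟨h1, h2⟩ j hj hj2
          rcases hj.eq_or_lt with rfl | hlt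
          · exact h1
          · exact h2 j hlt hj2
      have hc := walk_core h henv (B (i + 1)) (hBm _) _ (S (i + 1)) (a (i + 1))
        (ih (i + 1) (by omega)) (m i) (S i) (by simp [S, Finset.sum_range_succ]) path h0
      rw [hBi, hc, hp, Finset.prod_eq_prod_Ico_succ_bot (by omega : i < J)]
  have h1 := key J 0 (by omega) (fun _ => 0) rfl (by simp [ha])
  have hcyl : (cyl (S 0) (fun _ => 0) : Set (ℕ → ℤ)) =ᵐ[μ] (univ : Set (ℕ → ℤ)) := by
    refine Filter.eventuallyEq_set.2 ?_
    filter_upwards [walk_start h] with f hf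
    simp only [mem_univ, iff_true, S, cyl]
    intro k hk
    simp at hk; rw [hk]; exact hf
  have := h.1
  have h2 : μ (cyl (S 0) (fun _ => 0)) = 1 := by rw [measure_congr hcyl, measure_univ]
  have h3 : μ (cyl (S 0) (fun _ => 0) ∩ B 0) = μ (B 0) := by
    have := hcyl.inter (ae_eq_refl (B 0))
    rw [measure_congr this, univ_inter]
  rw [h3, h2, one_mul, ← Finset.range_eq_Ico] at h1
  rw [← h1]
  congr 1
  ext f; simp [B, S]

end walk

/-- Hitting times and first hits, for a fixed nice trajectory. -/
lemma hit_iff (f : ℕ → ℤ) (a : ℕ → ℤ) (ha0 : a 0 = 0) (hmono : StrictMono a) (hf0 : f 0 = 0)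
    (hstep : ∀ n, f (n + 1) = f n + 1 ∨ f (n + 1) = f n - 1) (hhit : ∀ n, ∃ k, f k = a n)
    (m : ℕ → ℕ) (J : ℕ) :
    (∀ j < J, hitTimeN f (a (j + 1)) - hitTimeN f (a j) = m j) ↔
    ∀ j < J, f ∈ firstHit (∑ i ∈ Finset.range j, m i)
      (∑ i ∈ Finset.range (j + 1), m i) (a (j + 1)) := by
  set T : ℕ → ℕ := fun n => hitTimeN f (a n) with hT
  have hTmem : ∀ n, f (T n) = a n := fun n => Nat.sInf_mem (s := {k | f k = a n}) (hhit n)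
  have hTle : ∀ n k, f k = a n → T n ≤ k := fun n k hk => Nat.sInf_le (s := {k | f k = a n}) hk
  have hT0 : T 0 = 0 := by have := hTle 0 0 (by rw [hf0, ha0]); omega
  have ivt : ∀ k (y : ℤ), 0 ≤ y → y ≤ f k → ∃ i ≤ k, f i = y := by
    intro k
    induction k with
    | zero => intro y h1 h2; exact ⟨0, le_rfl, by omega⟩
    | succ k ih =>
      intro y h1 h2
      by_cases hy : y ≤ f k
      · obtain ⟨i, hi, hfi⟩ := ih y h1 hy; exact ⟨i, by omega, hfi⟩
      · refine ⟨k + 1, le_rfl, ?_⟩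
        rcases hstep k with hk | hk <;> omega
  have hann : ∀ n, 0 ≤ a n := fun n => by rw [← ha0]; exact hmono.monotone (Nat.zero_le _)
  have hTmono : ∀ n, T n ≤ T (n + 1) := by
    intro n
    obtain ⟨i, hi, hfi⟩ := ivt (T (n + 1)) (a n) (hann n)
      (by rw [hTmem]; exact hmono.monotone (Nat.le_succ _))
    exact (hTle n i hfi).trans hi
  set S : ℕ → ℕ := fun j => ∑ i ∈ Finset.range j, m i with hS
  have hSs : ∀ j, S (j + 1) = S j + m j := fun j => Finset.sum_range_succ _ _
  have hS0 : S 0 = 0 := rfl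
  constructor
  · intro hh
    have hTS : ∀ j ≤ J, T j = S j := by
      intro j
      induction j with
      | zero => intro _; rw [hT0, hS0]
      | succ j ih =>
        intro hj
        have h1 := hh j (by omega)
        have h2 := ih (by omega)
        have h3 := hTmono j
        have h4 := hSs j
        change T (j + 1) - T j = m j at h1
        omega
    intro j hj
    have h1 := hTS (j + 1) hj
    refine ⟨(congrArg f h1).symm.trans (hTmem _), fun k _ hk hfk => ?_⟩
    have := hTle (j + 1) k hfk
    change k < S (j + 1) at hk
    omega
  · intro hh
    have hTS : ∀ j ≤ J, T j = S j := by
      intro j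
      induction j with
      | zero => intro _; rw [hT0, hS0]
      | succ j ih =>
        intro hj
        obtain ⟨h1, h5⟩ := hh j (by omega)
        have h2 := ih (by omega)
        have h3 := hTmono j
        have h4 := hTle (j + 1) (S (j + 1)) h1
        by_contra hne
        exact h5 (T (j + 1)) (show S j ≤ _ by omega) (show _ < S (j + 1) by omega) (hTmem _)
    intro j hj
    have h1 := hTS (j + 1) hj
    have h2 := hTS j hj.le
    have h3 := hSs j
    change T (j + 1) - T j = m j
    omega

lemma hits_of_limsup (f : ℕ → ℤ) (hf0 : f 0 = 0)
    (hstep : ∀ n, f (n + 1) = f n + 1 ∨ f (n + 1) = f n - 1)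
    (hl : atTop.limsup (fun n => ((f n : ℝ) : EReal)) = ⊤) (y : ℤ) (hy : 0 ≤ y) :
    ∃ k, f k = y := by
  have ivt : ∀ k (y : ℤ), 0 ≤ y → y ≤ f k → ∃ i ≤ k, f i = y := by
    intro k
    induction k with
    | zero => intro y h1 h2; exact ⟨0, le_rfl, by omega⟩
    | succ k ih =>
      intro y h1 h2
      by_cases hy : y ≤ f k
      · obtain ⟨i, hi, hfi⟩ := ih y h1 hy; exact ⟨i, by omega, hfi⟩
      · refine ⟨k + 1, le_rfl, ?_⟩
        rcases hstep k with hk | hk <;> omega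
  have h1 : (((y : ℝ) : EReal)) < atTop.limsup (fun n => ((f n : ℝ) : EReal)) := by
    rw [hl]; exact EReal.coe_lt_top _
  obtain ⟨k, hk⟩ := (frequently_lt_of_lt_limsup (by isBoundedDefault) h1).exists
  have hk' : y < f k := by exact_mod_cast hk
  obtain ⟨i, _, hi⟩ := ivt k y hy hk'.le
  exact ⟨i, hi⟩

/-- Positions of the marked sites as a function of the environment. -/
def posE (e : ℤ → ℝ × ℕ) (k : ℤ) : ℤ :=
  ∑ i ∈ Finset.Ioc 0 k, ((e i).2 : ℤ) - ∑ i ∈ Finset.Ioc k 0, ((e i).2 : ℤ)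

lemma posE_zero (e : ℤ → ℝ × ℕ) : posE e 0 = 0 := by simp [posE]

lemma posE_rec (e : ℤ → ℝ × ℕ) (k : ℤ) : posE e k - posE e (k - 1) = (e k).2 := by
  unfold posE
  rcases le_or_gt 1 k with hk | hk
  · have h1 : Finset.Ioc 0 k = insert k (Finset.Ioc 0 (k - 1)) := by ext; simp; omega
    have h2 : Finset.Ioc k 0 = ∅ := by ext; simp; omega
    have h3 : Finset.Ioc (k - 1) 0 = ∅ := by ext; simp; omega
    rw [h1, h2, h3, Finset.sum_insert (by simp)]
    simp
  · have h1 : Finset.Ioc (k - 1) 0 = insert k (Finset.Ioc k 0) := by ext; simp; omega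
    have h2 : Finset.Ioc 0 k = ∅ := by ext; simp; omega
    have h3 : Finset.Ioc 0 (k - 1) = ∅ := by ext; simp; omega
    rw [h1, h2, h3, Finset.sum_insert (by simp)]
    simp

lemma pos_uniq (a b : ℤ → ℤ) (h0 : a 0 = b 0) (h : ∀ k, a k - a (k - 1) = b k - b (k - 1)) :
    a = b := by
  funext k
  induction k using Int.induction_on with
  | zero => exact h0
  | succ i ih => have := h (i + 1); simp only [add_sub_cancel_right] at this; omega
  | pred i ih => have := h (-i); omega

lemma posE_meas (k : ℤ) : Measurable fun e => posE e k := by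
  have : ∀ i : ℤ, Measurable fun e : ℤ → ℝ × ℕ => ((e i).2 : ℤ) := fun i =>
    (measurable_from_top (f := fun n : ℕ => (n : ℤ))).comp
      (measurable_snd.comp (measurable_pi_apply i))
  unfold posE
  exact (Finset.measurable_sum _ fun i _ => this i).sub (Finset.measurable_sum _ fun i _ => this i)

/-- The sparse environment, as a measurable function on the canonical space. -/
def envE (e : ℤ → ℝ × ℕ) (x : ℤ) : ℝ :=
  1 / 2 + ∑ k ∈ Finset.Icc (-|x|) |x|, if posE e k = x then (e k).1 - 1 / 2 else 0

lemma envE_meas (x : ℤ) : Measurable fun e => envE e x := by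
  unfold envE
  refine measurable_const.add (Finset.measurable_sum _ fun k _ => ?_)
  refine Measurable.ite ?_ ?_ measurable_const
  · exact posE_meas k (measurableSet_singleton x)
  · exact (measurable_fst.comp (measurable_pi_apply k)).sub measurable_const

lemma pos_strictMono (a : ℤ → ℤ) (d : ℤ → ℕ) (hd : ∀ k, 1 ≤ d k)
    (h : ∀ k, a k - a (k - 1) = d k) : StrictMono a := by
  refine strictMono_int_of_lt_succ fun k => ?_
  have h1 := h (k + 1)
  have h2 := hd (k + 1)
  simp only [add_sub_cancel_right] at h1
  omega

lemma pos_abs (a : ℤ → ℤ) (h0 : a 0 = 0) (hm : StrictMono a) (k : ℤ) : |k| ≤ |a k| := by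
  have h1 : ∀ k : ℕ, (k : ℤ) ≤ a k := by
    intro k
    induction k with
    | zero => simp [h0]
    | succ k ih => 
      have := hm (show (k : ℤ) < (k + 1 : ℕ) by push_cast; omega)
      push_cast at *; omega
  have h2 : ∀ k : ℕ, a (-(k : ℤ)) ≤ -k := by
    intro k
    induction k with
    | zero => simp [h0]
    | succ k ih => 
      have := hm (show (-((k + 1 : ℕ) : ℤ)) < -k by push_cast; omega)
      push_cast at *; omega
  rcases le_total 0 k with hk | hk
  · have := h1 k.toNat
    rw [Int.toNat_of_nonneg hk] at this
    rw [abs_of_nonneg hk, abs_of_nonneg (hk.trans this)]; exact this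
  · have := h2 (-k).toNat
    rw [Int.toNat_of_nonneg (by omega), neg_neg] at this
    rw [abs_of_nonpos hk, abs_of_nonpos (this.trans hk)]; omega

lemma sparseEnv_at (lam : ℤ → ℝ) (a : ℤ → ℤ) (ha : Function.Injective a) (k : ℤ) :
    sparseEnv lam a (a k) = lam k := by
  have h : ∃ i, a i = a k := ⟨k, rfl⟩
  unfold sparseEnv
  rw [dif_pos h, ha h.choose_spec]

lemma sparseEnv_off (lam : ℤ → ℝ) (a : ℤ → ℤ) (x : ℤ) (h : ¬ ∃ k, a k = x) :
    sparseEnv lam a x = 1 / 2 := by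
  unfold sparseEnv
  rw [dif_neg h]

lemma sparseEnv_shift (lam : ℤ → ℝ) (a : ℤ → ℤ) (ha : Function.Injective a) (j c : ℤ) (x : ℤ) :
    sparseEnv (fun k => lam (k + j)) (fun k => a (k + j) - c) x = sparseEnv lam a (x + c) := by
  by_cases h : ∃ k, a k = x + c
  · obtain ⟨k, hk⟩ := h
    rw [← hk, sparseEnv_at _ _ ha]
    have hx : x = (fun k => a (k + j) - c) (k - j) := by simp; omega
    have hi : Function.Injective (fun k => a (k + j) - c) := by
      intro u v huv
      have := ha (sub_left_injective huv)
      omega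
    conv_lhs => rw [hx]
    rw [sparseEnv_at _ _ hi]
    simp
  · rw [sparseEnv_off _ _ _ h, sparseEnv_off]
    rintro ⟨k, hk⟩
    exact h ⟨k + j, by omega⟩

lemma envE_eq (e : ℤ → ℝ × ℕ) (hd : ∀ k, 1 ≤ (e k).2) (x : ℤ) :
    envE e x = sparseEnv (fun k => (e k).1) (posE e) x := by
  have hm : StrictMono (posE e) := pos_strictMono _ (fun k => (e k).2) hd (posE_rec e)
  unfold envE
  by_cases h : ∃ k, posE e k = x
  · obtain ⟨k, rfl⟩ := h
    rw [sparseEnv_at _ _ hm.injective]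
    rw [Finset.sum_eq_single k]
    · simp
    · intro b _ hb
      rw [if_neg (fun h => hb (hm.injective h))]
    · intro hk
      refine absurd ?_ hk
      rw [Finset.mem_Icc, ← abs_le]
      exact pos_abs _ (posE_zero e) hm k
  · rw [sparseEnv_off _ _ _ h, Finset.sum_eq_zero, add_zero]
    intro k _
    rw [if_neg (fun hk => h ⟨k, hk⟩)]

/-- The shift on environments. -/
def shiftE (f : ℤ → ℝ × ℕ) : ℤ → ℝ × ℕ := fun n => f (n + 1)

lemma shiftE_iterate (j : ℕ) (e : ℤ → ℝ × ℕ) (n : ℤ) : (shiftE^[j]) e n = e (n + j) := by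
  induction j generalizing e n with
  | zero => simp
  | succ j ih => rw [Function.iterate_succ_apply, ih]; simp [shiftE]; congr 1; ring

/-- Weights of the law of the first crossing time. -/
def crossW (e : ℤ → ℝ × ℕ) (m : ℕ) : ℝ≥0∞ := hitW (envE e) (posE e 1) m 0

lemma crossW_meas (m : ℕ) : Measurable fun e => crossW e m := by
  have : ∀ m x, Measurable fun e => hitW (envE e) (posE e 1) m x := by
    intro m
    induction m with
    | zero =>
      intro x
      simp only [hitW]
      exact Measurable.ite (measurableSet_eq_fun measurable_const (posE_meas 1))
        measurable_const measurable_const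
    | succ m ih =>
      intro x
      simp only [hitW]
      refine Measurable.ite (measurableSet_eq_fun measurable_const (posE_meas 1))
        measurable_const ?_
      exact ((envE_meas x).ennreal_ofReal.mul (ih _)).add
        (((measurable_const.sub (envE_meas x)).ennreal_ofReal).mul (ih _))
  exact this m 0

/-- Law of the first crossing time (a default value where the weights do not sum to one). -/
def crossLaw (e : ℤ → ℝ × ℕ) : Measure ℕ :=
  open Classical in
  if ∑' m, crossW e m = 1 then Measure.sum (fun m => crossW e m • Measure.dirac m)
  else Measure.dirac 0

lemma crossSum_apply (e : ℤ → ℝ × ℕ) (s : Set ℕ) :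
    Measure.sum (fun m => crossW e m • Measure.dirac m) s 
      = ∑' m, crossW e m * s.indicator 1 m := by
  rw [Measure.sum_apply _ MeasurableSet.of_discrete]
  simp

lemma crossLaw_meas : Measurable crossLaw := by
  refine Measurable.ite ?_ ?_ measurable_const
  · exact (Measurable.tsum crossW_meas) (measurableSet_singleton 1)
  · refine Measure.measurable_of_measurable_coe _ fun s _ => ?_
    simp_rw [crossSum_apply]
    exact Measurable.tsum fun m => (crossW_meas m).mul_const _

instance (e : ℤ → ℝ × ℕ) : IsProbabilityMeasure (crossLaw e) := by
  unfold crossLaw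
  split_ifs with h
  · refine ⟨?_⟩
    rw [crossSum_apply]; simpa using h
  · infer_instance

lemma crossLaw_singleton (e : ℤ → ℝ × ℕ) (h : ∑' m, crossW e m = 1) (m : ℕ) :
    crossLaw e {m} = crossW e m := by
  unfold crossLaw
  rw [if_pos h, crossSum_apply, tsum_eq_single m]
  · simp
  · intro b hb; simp [hb]

/-- The law of the first crossing time as a kernel. -/
def crossK : Kernel (ℤ → ℝ × ℕ) ℕ := ⟨crossLaw, crossLaw_meas⟩

instance : IsMarkovKernel crossK := ⟨fun e => inferInstanceAs (IsProbabilityMeasure (crossLaw e))⟩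

lemma crossK_singleton (e : ℤ → ℝ × ℕ) (h : ∑' m, crossW e m = 1) (m : ℕ) :
    crossK e {m} = crossW e m := crossLaw_singleton e h m

lemma crossW_shift (e : ℤ → ℝ × ℕ) (hd : ∀ k, 1 ≤ (e k).2) (j m : ℕ) :
    crossW (shiftE^[j] e) m = 
      hitW (sparseEnv (fun k => (e k).1) (posE e)) (posE e (j + 1)) m (posE e j) := by
  have hm : StrictMono (posE e) := pos_strictMono _ (fun k => (e k).2) hd (posE_rec e)
  have hpos : posE (shiftE^[j] e) = fun k => posE e (k + j) - posE e j := by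
    refine pos_uniq _ _ (by simp [posE_zero]) fun k => ?_
    rw [posE_rec, shiftE_iterate, ← posE_rec]
    rw [show k + (j : ℤ) - 1 = k - 1 + j by ring]; ring
  have henv : envE (shiftE^[j] e) = 
      fun x => sparseEnv (fun k => (e k).1) (posE e) (x + posE e j) := by
    funext x
    rw [envE_eq _ (fun k => by rw [shiftE_iterate]; exact hd _), hpos]
    simp_rw [shiftE_iterate]
    exact sparseEnv_shift (fun k => (e k).1) _ hm.injective _ _ _
  unfold crossW
  rw [henv, hitW_shift, hpos]
  congr 1
  · ring_nf
  · ring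

lemma hitTime_meas {α : Type*} [MeasurableSpace α] (f : α → ℕ → ℤ) (y : α → ℤ)
    (hf : Measurable f) (hy : Measurable y) : Measurable fun p => hitTimeN (f p) (y p) := by
  have hk : ∀ k, MeasurableSet {p | f p k = y p} := fun k =>
    measurableSet_eq_fun ((measurable_pi_apply k).comp hf) hy
  refine measurable_to_countable' fun n => ?_
  have : (fun p => hitTimeN (f p) (y p)) ⁻¹' {n} = 
      ({p | f p n = y p} ∩ ⋂ k, ⋂ (_ : k < n), {p | f p k = y p}ᶜ) ∪
      ({_p | n = 0} ∩ ⋂ k, {p | f p k = y p}ᶜ) := by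
    ext p
    simp only [mem_preimage, mem_singleton_iff, mem_union, mem_inter_iff, mem_ofPred_eq, mem_iInter,
      mem_compl_iff]
    unfold hitTimeN
    constructor
    · rintro rfl
      by_cases hne : ∃ k, f p k = y p
      · left
        exact ⟨Nat.sInf_mem (s := {k | f p k = y p}) hne, fun k hk => Nat.notMem_of_lt_sInf hk⟩
      · right
        push Not at hne
        refine ⟨?_, hne⟩
        have : {k | f p k = y p} = ∅ := by ext k; simp [hne k]
        rw [this, Nat.sInf_empty]
    · rintro (⟨h1, h2⟩ | ⟨h1, h2⟩)
      · refine le_antisymm (Nat.sInf_le h1) ?_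
        by_contra hlt
        push Not at hlt
        exact h2 _ hlt (Nat.sInf_mem (s := {k | f p k = y p}) ⟨n, h1⟩)
      · have : {k | f p k = y p} = ∅ := by ext k; simp [h2 k]
        rw [this, Nat.sInf_empty, h1]
  rw [this]
  refine ((hk n).inter (MeasurableSet.iInter fun k => MeasurableSet.iInter fun _ => 
    (hk k).compl)).union ((MeasurableSet.const _).inter (MeasurableSet.iInter fun k => (hk k).compl))

/-- Lemma `ste-lemma`: the sequence `τ_n = T_{a_n} - T_{a_{n-1}}`,
`n ≥ 1`, is stationary and ergodic under the annealed law `ℙ`. -/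
theorem statement13
    {Ω : Type*} [MeasurableSpace Ω] (P : Measure Ω) [IsProbabilityMeasure P]
    (lam : ℤ → Ω → ℝ) (d : ℤ → Ω → ℕ) (a : ℤ → Ω → ℤ)
    (hlam_meas : ∀ k, Measurable (lam k)) (hd_meas : ∀ k, Measurable (d k))
    (hlam01 : ∀ k, ∀ᵐ ω ∂P, lam k ω ∈ Set.Ioo (0 : ℝ) 1)
    (hd_pos : ∀ k ω, 1 ≤ d k ω)
    (ha0 : ∀ ω, a 0 ω = 0)
    (ha_rec : ∀ ω, ∀ k : ℤ, a k ω - a (k - 1) ω = d k ω)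
    -- stationarity and ergodicity of `(d_n, λ_n)` under `P`
    (h_erg : Ergodic (fun f : ℤ → ℝ × ℕ => fun n => f (n + 1))
      (P.map fun ω => fun n : ℤ => (lam n ω, d n ω)))
    -- `E_P (log ξ_0)` exists in `[-∞, ∞]`
    (hexists :
      (∫⁻ ω, ENNReal.ofReal (Real.log ((1 - lam 0 ω) / lam 0 ω)) ∂P ≠ ⊤) ∨
      (∫⁻ ω, ENNReal.ofReal (-Real.log ((1 - lam 0 ω) / lam 0 ω)) ∂P ≠ ⊤))
    -- `E_P (log d_0) < ∞`
    (hlogd : ∫⁻ ω, ENNReal.ofReal (Real.log (d 0 ω)) ∂P ≠ ⊤)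
    -- quenched law and annealed law
    (K : Kernel Ω (ℕ → ℤ)) [IsMarkovKernel K]
    (hK : ∀ ω, IsQuenchedRW (sparseEnv (fun k => lam k ω) (fun k => a k ω)) 0 (K ω))
    -- `ℙ(limsup X_n = +∞) = 1`
    (h_limsup : ∀ᵐ p ∂(P ⊗ₘ K),
      atTop.limsup (fun n => ((p.2 n : ℝ) : EReal)) = ⊤) :
    -- the hitting times `T_{a_n}`, `n ∈ ℕ`, are ℙ-a.s. finite …
    (∀ n : ℕ, ∀ᵐ p ∂(P ⊗ₘ K), ∃ k : ℕ, p.2 k = a (n : ℤ) p.1) ∧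
    -- … and `(τ_n)_{n≥1}` is stationary and ergodic under `ℙ`
    Ergodic (fun s : ℕ → ℕ => fun k => s (k + 1))
      ((P ⊗ₘ K).map (fun p => fun n : ℕ =>
        hitTimeN p.2 (a ((n : ℤ) + 1) p.1) - hitTimeN p.2 (a (n : ℤ) p.1))) := by
  have ha_mono : ∀ ω, StrictMono (fun k => a k ω) := fun ω =>
    pos_strictMono _ (fun k => d k ω) (fun k => hd_pos k ω) (ha_rec ω)
  let ev : Ω → (ℤ → ℝ × ℕ) := fun ω n => (lam n ω, d n ω)
  have hev : Measurable ev := measurable_pi_lambda _ fun n => (hlam_meas n).prodMk (hd_meas n)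
  have hpos : ∀ ω, (fun k => a k ω) = posE (ev ω) := fun ω =>
    pos_uniq _ _ (by simp [ha0, posE_zero]) fun k => by rw [posE_rec]; exact ha_rec ω k
  have hpos' : ∀ ω k, a k ω = posE (ev ω) k := fun ω k => congrFun (hpos ω) k
  have ha_meas : ∀ k, Measurable (a k) := by
    intro k
    have : a k = fun ω => posE (ev ω) k := funext fun ω => hpos' ω k
    rw [this]; exact (posE_meas k).comp hev
  have hgood : ∀ᵐ ω ∂P, ∀ᵐ f ∂(K ω), f 0 = 0 ∧
      (∀ n, f (n + 1) = f n + 1 ∨ f (n + 1) = f n - 1) ∧ ∀ n : ℕ, ∃ k, f k = a (n : ℤ) ω := by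
    filter_upwards [Measure.ae_ae_of_ae_compProd h_limsup] with ω hω
    filter_upwards [hω, walk_start (hK ω), walk_step (hK ω)] with f h1 h2 h3
    refine ⟨h2, h3, fun n => hits_of_limsup f h2 h3 h1 _ ?_⟩
    rw [← ha0 ω]
    exact (ha_mono ω).monotone (Int.natCast_nonneg n)
  have hhit_meas : ∀ n : ℤ, Measurable fun p : Ω × (ℕ → ℤ) => hitTimeN p.2 (a n p.1) := fun n =>
    hitTime_meas _ _ measurable_snd ((ha_meas n).comp measurable_fst)
  refine ⟨fun n => ?_, ?_⟩
  · have hms : MeasurableSet {p : Ω × (ℕ → ℤ) | ∃ k : ℕ, p.2 k = a (n : ℤ) p.1} := by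
      have : {p : Ω × (ℕ → ℤ) | ∃ k : ℕ, p.2 k = a (n : ℤ) p.1} =
          ⋃ k : ℕ, {p : Ω × (ℕ → ℤ) | p.2 k = a (n : ℤ) p.1} := by ext p; simp
      rw [this]
      exact MeasurableSet.iUnion fun k => measurableSet_eq_fun
        ((measurable_pi_apply k).comp measurable_snd) ((ha_meas n).comp measurable_fst)
    rw [Measure.ae_compProd_iff hms]
    filter_upwards [hgood] with ω hω
    filter_upwards [hω] with f hf using hf.2.2 n
  · let τ : Ω × (ℕ → ℤ) → ℕ → ℕ := fun p n =>
      hitTimeN p.2 (a ((n : ℤ) + 1) p.1) - hitTimeN p.2 (a (n : ℤ) p.1)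
    have hτ : Measurable τ := measurable_pi_lambda _ fun n => (hhit_meas _).sub (hhit_meas _)
    have hQp : IsProbabilityMeasure (P.map ev) :=
      Measure.isProbabilityMeasure_map hev.aemeasurable
    have hτω : ∀ ω, Measurable fun f => τ (ω, f) := fun ω => hτ.comp measurable_prodMk_left
    have hcyl : ∀ᵐ ω ∂P, ∀ (J : ℕ) (m : ℕ → ℕ),
        (K ω).map (fun f => τ (ω, f)) {s | ∀ j < J, s j = m j} =
          ∏ j ∈ Finset.range J, crossW (shiftE^[j] (ev ω)) (m j) := by
      filter_upwards [hgood, ae_all_iff.2 hlam01] with ω hω hl J m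
      have hms : MeasurableSet {s : ℕ → ℕ | ∀ j < J, s j = m j} := by
        have : {s : ℕ → ℕ | ∀ j < J, s j = m j} =
          ⋂ j, ⋂ (_ : j < J), (fun s : ℕ → ℕ => s j) ⁻¹' {m j} := by ext p; simp
        rw [this]
        exact MeasurableSet.iInter fun k => MeasurableSet.iInter fun _ =>
          measurable_pi_apply k (measurableSet_singleton _)
      rw [Measure.map_apply (hτω ω) hms]
      have henv : ∀ x, 0 ≤ sparseEnv (fun k => lam k ω) (fun k => a k ω) x ∧
          sparseEnv (fun k => lam k ω) (fun k => a k ω) x ≤ 1 := by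
        intro x
        by_cases hx : ∃ k, a k ω = x
        · obtain ⟨k, rfl⟩ := hx
          have := sparseEnv_at (fun k => lam k ω) (fun k => a k ω) (ha_mono ω).injective k
          rw [this]
          exact ⟨(hl k).1.le, (hl k).2.le⟩
        · rw [sparseEnv_off _ _ _ hx]; norm_num
      have hj := walk_joint (hK ω) henv (fun n : ℕ => a (n : ℤ) ω) (ha0 ω) m J
      have hmonoN : StrictMono (fun n : ℕ => a (n : ℤ) ω) := fun u v huv =>
        ha_mono ω (by exact_mod_cast huv)
      have hae : ((fun f => τ (ω, f)) ⁻¹' {s : ℕ → ℕ | ∀ j < J, s j = m j} : Set (ℕ → ℤ))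
          =ᵐ[K ω] ({f | ∀ j < J, f ∈ firstHit (∑ i ∈ Finset.range j, m i)
            (∑ i ∈ Finset.range (j + 1), m i) (a ((j + 1 : ℕ) : ℤ) ω)} : Set (ℕ → ℤ)) := by
        refine Filter.eventuallyEq_set.2 ?_
        filter_upwards [hω] with f hf
        have := hit_iff f (fun n : ℕ => a (n : ℤ) ω) (ha0 ω) hmonoN hf.1 hf.2.1 hf.2.2 m J
        simp only [mem_preimage, mem_ofPred_eq]
        rw [← this]
        simp [τ]
      rw [measure_congr hae, hj]
      refine Finset.prod_congr rfl fun j _ => ?_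
      rw [crossW_shift (ev ω) (fun k => hd_pos k ω), ← hpos ω]
      push_cast
      rfl
    have hsumms : MeasurableSet {e : ℤ → ℝ × ℕ | ∑' m, crossW e m = 1} :=
      (Measurable.tsum crossW_meas) (measurableSet_singleton 1)
    have hsum : ∀ᵐ e ∂(P.map ev), ∑' m, crossW e m = 1 := by
      rw [ae_map_iff hev.aemeasurable hsumms]
      filter_upwards [hcyl] with ω hω
      have hp : IsProbabilityMeasure ((K ω).map (fun f => τ (ω, f))) :=
        Measure.isProbabilityMeasure_map (hτω ω).aemeasurable
      have h1 : ∀ m, crossW (ev ω) m =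
          (((K ω).map (fun f => τ (ω, f))).map (fun s : ℕ → ℕ => s 0)) {m} := by
        intro m
        have := hω 1 (fun _ => m)
        rw [Measure.map_apply (measurable_pi_apply 0) (measurableSet_singleton _)]
        simp only [Finset.range_one, Finset.prod_singleton, Function.iterate_zero, id] at this
        rw [← this]
        congr 1
        ext s; simp
      have hp2 : IsProbabilityMeasure
          (((K ω).map (fun f => τ (ω, f))).map (fun s : ℕ → ℕ => s 0)) :=
        Measure.isProbabilityMeasure_map (measurable_pi_apply 0).aemeasurable
      simp_rw [h1]
      rw [← hp2.measure_univ, ← Measure.tsum_indicator_apply_singleton _ univ .univ]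
      simp
    have hErg : Ergodic shiftE (P.map ev) := h_erg
    have hsum' : ∀ᵐ ω ∂P, ∀ j : ℕ, ∑' m, crossW (shiftE^[j] (ev ω)) m = 1 := by
      rw [ae_all_iff]
      intro j
      exact ae_of_ae_map hev.aemeasurable
        ((hErg.toMeasurePreserving.iterate j).quasiMeasurePreserving.ae hsum)
    have hlaw : ∀ᵐ ω ∂P, (K ω).map (fun f => τ (ω, f)) = prodLaw shiftE crossK (ev ω) := by
      filter_upwards [hcyl, hsum'] with ω h1 h2
      refine eq_prodLaw _ _ _ _ fun J m => ?_
      rw [h1]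
      exact Finset.prod_congr rfl fun j _ => (crossK_singleton _ (h2 j) _).symm
    refine ergodic_of_prodLaw hErg crossK _ fun A hA => ?_
    have hmA : Measurable fun e => prodLaw shiftE crossK e A :=
      (Measure.measurable_coe hA).comp (prodLaw_measurable hErg.measurable crossK)
    rw [lintegral_map hmA hev]
    change (P ⊗ₘ K).map τ A = _
    rw [Measure.map_apply hτ hA, Measure.compProd_apply (hτ hA)]
    refine lintegral_congr_ae ?_
    filter_upwards [hlaw] with ω hω
    rw [← hω, Measure.map_apply (hτω ω) hA]
    rfl
end
end

section
/- Assume (d_n, λ_n)_{n∈ℤ} is stationary and ergodic under P, E_P(log ξ_0) exists, E_P(log d_0) < ∞, E_P(d_1) < ∞, the random walk is transient to the right (lim_{n→∞} X_n = +∞ ℙ-a.s.), and there is a constant α ∈ (0, +∞] such that lim_{n→∞} T_{a_n}/n = α ℙ-almost surely. Then ℙ-almost surely lim_{n→∞} T_n/n = α/E_P(d_1) and lim_{n→∞} X_n/n = E_P(d_1)/α (with the conventions α/E_P(d_1) = +∞ and E_P(d_1)/α = 0 when α = +∞). -/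
open MeasureTheory ProbabilityTheory Filter Set
open scoped ENNReal NNReal Topology

noncomputable section

/-- `T_m = inf {k ≥ 0 : X_k = m}`, valued in `[0,∞]` (`∞` if the walk never hits `m`). -/
def hitTime (f : ℕ → ℤ) (m : ℤ) : ℝ≥0∞ :=
  ⨅ k ∈ {k : ℕ | f k = m}, (k : ℝ≥0∞)

/-! ### Pointwise ergodic theorem (ergodic case) -/

section Birkhoff

variable {E : Type*} [MeasurableSpace E] {μ : Measure E} {T : E → E} {g : E → ℝ}

/-- Running maximum of the Birkhoff sums, defined recursively. -/
def maxSum (T : E → E) (g : E → ℝ) : ℕ → E → ℝ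
  | 0 => fun _ => 0
  | n + 1 => fun x => max 0 (g x + maxSum T g n (T x))

lemma maxSum_nonneg (n : ℕ) (x : E) : 0 ≤ maxSum T g n x := by
  cases n <;> simp [maxSum]

lemma maxSum_mono_succ (n : ℕ) : ∀ x : E, maxSum T g n x ≤ maxSum T g (n + 1) x := by
  induction n with
  | zero => intro x; exact maxSum_nonneg _ _
  | succ n ih =>
    intro x
    have := ih (T x)
    simp only [maxSum] at this ⊢
    gcongr

lemma birkhoffSum_le_maxSum (n : ℕ) : ∀ x : E, birkhoffSum T g n x ≤ maxSum T g n x := by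
  induction n with
  | zero => intro x; simp [maxSum]
  | succ n ih =>
    intro x
    rw [birkhoffSum_succ']
    simp only [maxSum]
    exact le_max_of_le_right (by linarith [ih (T x)])

lemma maxSum_measurable (hT : Measurable T) (hg : Measurable g) (n : ℕ) :
    Measurable (maxSum T g n) := by
  induction n with
  | zero => exact measurable_const
  | succ n ih => exact measurable_const.max (hg.add (ih.comp hT))

lemma maxSum_integrable [IsFiniteMeasure μ] (hT : MeasurePreserving T μ μ)
    (hgi : Integrable g μ) (n : ℕ) : Integrable (maxSum T g n) μ := by
  induction n with
  | zero => exact integrable_const _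
  | succ n ih =>
    have h := hgi.add (hT.integrable_comp_of_integrable ih)
    exact (integrable_const (0 : ℝ)).sup h

lemma maxSum_diff (n : ℕ) (x : E) :
    maxSum T g (n + 1) x - maxSum T g n (T x) = max (-maxSum T g n (T x)) (g x) := by
  simp only [maxSum]
  rw [← max_sub_sub_right]
  congr 1 <;> ring

lemma birkhoff_bdd [IsProbabilityMeasure μ] (hT : Ergodic T μ) (hg : Measurable g)
    (hgi : Integrable g μ) (hneg : ∫ x, g x ∂μ < 0) :
    ∀ᵐ x ∂μ, ∃ B : ℝ, ∀ n, birkhoffSum T g n x ≤ B := by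
  set A : Set E := {x | ∃ N : ℕ, ∀ n, birkhoffSum T g n x ≤ N} with hA
  have hS : ∀ n, Measurable (birkhoffSum T g n) := fun n => by
    unfold birkhoffSum
    exact Finset.measurable_sum _ fun i _ => hg.comp (hT.measurable.iterate i)
  have hAm : MeasurableSet A := by
    have : A = ⋃ N : ℕ, ⋂ n : ℕ, {x | birkhoffSum T g n x ≤ N} := by
      ext x; simp [hA]
    rw [this]
    exact MeasurableSet.iUnion fun N => MeasurableSet.iInter fun n =>
      measurableSet_le (hS n) measurable_const
  have hAinv : T ⁻¹' A = A := by
    ext x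
    simp only [hA, mem_preimage, mem_ofPred_eq]
    constructor
    · rintro ⟨N, hN⟩
      obtain ⟨N', hN'⟩ := exists_nat_ge (max 0 (g x + N))
      refine ⟨N', fun n => ?_⟩
      cases n with
      | zero => simp
      | succ n =>
        rw [birkhoffSum_succ']
        exact le_trans (by linarith [hN n]) ((le_max_right _ _).trans hN')
    · rintro ⟨N, hN⟩
      obtain ⟨N', hN'⟩ := exists_nat_ge (N - g x)
      refine ⟨N', fun n => ?_⟩
      have := hN (n + 1)
      rw [birkhoffSum_succ'] at this
      linarith
  rcases hT.toPreErgodic.ae_mem_or_ae_notMem hAm hAinv with h | h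
  · filter_upwards [h] with x hx
    obtain ⟨N, hN⟩ := hx
    exact ⟨N, hN⟩
  · exfalso
    have hTA : ∀ᵐ x ∂μ, T x ∉ A := hT.toMeasurePreserving.quasiMeasurePreserving.ae h
    have hlim : Tendsto (fun n => ∫ x, max (-maxSum T g n (T x)) (g x) ∂μ) atTop
        (𝓝 (∫ x, g x ∂μ)) := by
      refine tendsto_integral_of_dominated_convergence (fun x => |g x|) ?_ hgi.abs ?_ ?_
      · intro n
        exact (((maxSum_measurable hT.measurable hg n).comp hT.measurable).neg.max
          hg).aestronglyMeasurable
      · intro n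
        refine Eventually.of_forall fun x => ?_
        have h0 := maxSum_nonneg (T := T) (g := g) n (T x)
        rw [Real.norm_eq_abs, abs_le]
        exact ⟨le_max_of_le_right (neg_abs_le _),
          max_le (by linarith [abs_nonneg (g x)]) (le_abs_self _)⟩
      · filter_upwards [hTA] with x hx
        simp only [hA, mem_ofPred_eq, not_exists, not_forall, not_le] at hx
        obtain ⟨N, hN⟩ := exists_nat_ge (-g x)
        obtain ⟨n, hn⟩ := hx N
        refine tendsto_const_nhds.congr' ?_
        filter_upwards [eventually_ge_atTop n] with k hk
        have h1 := birkhoffSum_le_maxSum (T := T) (g := g) n (T x)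
        have h2 : maxSum T g n (T x) ≤ maxSum T g k (T x) :=
          monotone_nat_of_le_succ (f := fun n => maxSum T g n (T x))
            (fun n => maxSum_mono_succ n _) hk
        rw [max_eq_right]
        linarith
    have hpos : ∀ n, 0 ≤ ∫ x, max (-maxSum T g n (T x)) (g x) ∂μ := by
      intro n
      have hi := fun n => maxSum_integrable hT.toMeasurePreserving hgi n
      simp_rw [← maxSum_diff]
      have hi2 : Integrable (fun x => maxSum T g n (T x)) μ :=
        hT.toMeasurePreserving.integrable_comp_of_integrable (hi n)
      rw [integral_sub (hi _) hi2]
      have : ∫ x, maxSum T g n (T x) ∂μ = ∫ x, maxSum T g n x ∂μ := by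
        have hm := (hi n).aestronglyMeasurable
        rw [← hT.toMeasurePreserving.map_eq] at hm
        rw [← integral_map hT.measurable.aemeasurable hm, hT.toMeasurePreserving.map_eq]
      rw [this, sub_nonneg]
      exact integral_mono (hi _) (hi _) (maxSum_mono_succ n)
    exact absurd (ge_of_tendsto' hlim hpos) (not_le.2 hneg)

lemma birkhoffSum_sub_const (c : ℝ) (n : ℕ) (x : E) :
    birkhoffSum T (fun x => g x - c) n x = birkhoffSum T g n x - n * c := by
  simp [birkhoffSum, Finset.sum_sub_distrib]

lemma birkhoff_upper [IsProbabilityMeasure μ] (hT : Ergodic T μ) (hg : Measurable g)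
    (hgi : Integrable g μ) :
    ∀ᵐ x ∂μ, ∀ ε > 0, ∀ᶠ n : ℕ in atTop, birkhoffSum T g n x / n < ∫ x, g x ∂μ + ε := by
  have key : ∀ j : ℕ, ∀ᵐ x ∂μ, ∃ B : ℝ, ∀ n, birkhoffSum T g n x
      - n * (∫ x, g x ∂μ + 1 / ((j : ℝ) + 1)) ≤ B := by
    intro j
    have hj : (0 : ℝ) < 1 / ((j : ℝ) + 1) := by positivity
    have := birkhoff_bdd (μ := μ) (g := fun x => g x - (∫ x, g x ∂μ + 1 / ((j : ℝ) + 1))) hT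
      (hg.sub_const _) (hgi.sub (integrable_const _)) (by
        rw [integral_sub hgi (integrable_const _)]
        simp only [integral_const, probReal_univ, one_smul]
        linarith)
    simpa only [birkhoffSum_sub_const] using this
  filter_upwards [ae_all_iff.2 key] with x hx ε hε
  obtain ⟨j, hj⟩ := exists_nat_one_div_lt hε
  obtain ⟨B, hB⟩ := hx j
  set δ := ε - 1 / ((j : ℝ) + 1) with hδ
  have hδ0 : 0 < δ := by rw [hδ]; linarith
  obtain ⟨N, hN⟩ := exists_nat_gt (B / δ)
  filter_upwards [eventually_ge_atTop (max N 1)] with n hn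
  have hn1 : (0 : ℝ) < n := by exact_mod_cast (le_max_right N 1).trans hn
  have hnN : (N : ℝ) ≤ n := by exact_mod_cast (le_max_left N 1).trans hn
  rw [div_lt_iff₀ hn1]
  have h1 : B < n * δ := by
    rw [div_lt_iff₀ hδ0] at hN
    nlinarith
  have h2 := hB n
  have h3 : (n : ℝ) * δ = n * ε - n * (1 / ((j : ℝ) + 1)) := by rw [hδ]; ring
  nlinarith

lemma birkhoff_tendsto [IsProbabilityMeasure μ] (hT : Ergodic T μ) (hg : Measurable g)
    (hgi : Integrable g μ) :
    ∀ᵐ x ∂μ, Tendsto (fun n : ℕ => birkhoffSum T g n x / n) atTop (𝓝 (∫ x, g x ∂μ)) := by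
  filter_upwards [birkhoff_upper hT hg hgi, birkhoff_upper hT hg.neg hgi.neg] with x h1 h2
  rw [tendsto_order]
  constructor
  · intro c hc
    filter_upwards [h2 (∫ x, g x ∂μ - c) (by linarith)] with n hn
    rw [birkhoffSum_neg, neg_div] at hn
    simp only [Pi.neg_apply, integral_neg] at hn
    linarith
  · intro c hc
    filter_upwards [h1 (c - ∫ x, g x ∂μ) (by linarith)] with n hn
    linarith

end Birkhoff

/-! ### Deterministic part -/

lemma exists_inverse (u : ℕ → ℕ) (hu : StrictMono u) (hu0 : u 0 = 0) :
    ∃ κ : ℕ → ℕ, (∀ n, u (κ n) ≤ n ∧ n < u (κ n + 1)) ∧ Tendsto κ atTop atTop := by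
  have h : ∀ n, ∃ k, u k ≤ n ∧ n < u (k + 1) := by
    intro n
    induction n with
    | zero => exact ⟨0, by omega, by have := hu (Nat.lt_succ_self 0); simp at *; omega⟩
    | succ n ih =>
      obtain ⟨k, h1, h2⟩ := ih
      by_cases h3 : n + 1 < u (k + 1)
      · exact ⟨k, by omega, h3⟩
      · exact ⟨k + 1, by omega, by
          have := hu (Nat.lt_succ_self (k + 1)); simp only [Nat.succ_eq_add_one] at this; omega⟩
  choose κ hκ using h
  refine ⟨κ, hκ, tendsto_atTop.2 fun b => ?_⟩
  filter_upwards [eventually_ge_atTop (u b)] with n hn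
  by_contra hlt
  have : u (κ n + 1) ≤ u b := hu.monotone (by omega)
  have := (hκ n).2
  omega

/-- Consequences of nearest-neighbour steps for the first hitting times. -/
lemma exists_hit (f : ℕ → ℤ) (f0 : f 0 = 0) (hf : ∀ k, f (k + 1) = f k + 1 ∨ f (k + 1) = f k - 1)
    (hlim : Tendsto f atTop atTop) :
    ∃ t : ℕ → ℕ, t 0 = 0 ∧ StrictMono t ∧ (∀ m : ℕ, hitTime f m = t m) ∧
      (∀ m : ℕ, f (t m) = m) ∧ (∀ m k : ℕ, k < t m → f k < m) := by
  classical
  have hex : ∀ m : ℕ, ∃ k, (m : ℤ) ≤ f k := fun m => (hlim.eventually_ge_atTop (m : ℤ)).exists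
  let t : ℕ → ℕ := fun m => Nat.find (hex m)
  have h1 : ∀ m : ℕ, (m : ℤ) ≤ f (t m) := fun m => Nat.find_spec (hex m)
  have h2 : ∀ m k : ℕ, k < t m → f k < m := fun m k hk => by
    have := Nat.find_min (hex m) hk
    omega
  have h3 : ∀ m : ℕ, f (t m) = m := by
    intro m
    have ha := h1 m
    rcases Nat.eq_zero_or_pos (t m) with h | h
    · rw [h, f0] at ha ⊢; omega
    · obtain ⟨j, hj⟩ := Nat.exists_eq_succ_of_ne_zero h.ne'
      have hb := h2 m j (by omega)
      rw [hj] at ha ⊢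
      rcases hf j with h | h <;> simp only [Nat.succ_eq_add_one] at * <;> omega
  refine ⟨t, ?_, ?_, ?_, h3, h2⟩
  · by_contra h
    have := h2 0 0 (Nat.pos_of_ne_zero h)
    simp [f0] at this
  · refine strictMono_nat_of_lt_succ fun m => ?_
    by_contra h
    rcases lt_or_eq_of_le (not_lt.1 h) with h | h
    · have := h2 _ _ h
      rw [h3] at this
      push_cast at this; omega
    · have a := h3 m
      have b := h3 (m + 1)
      rw [h] at b
      push_cast at b; omega
  · intro m
    unfold hitTime
    apply le_antisymm
    · exact iInf₂_le (t m) (h3 m)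
    · refine le_iInf₂ fun k hk => ?_
      have hk' : f k = m := hk
      have : t m ≤ k := by
        by_contra h
        have := h2 m k (by omega)
        omega
      exact_mod_cast this

lemma part_one (t b : ℕ → ℕ) (ht : StrictMono t) (hb : StrictMono b) (hb0 : b 0 = 0)
    (D : ℝ) (hD : 0 < D) (α : ℝ≥0∞)
    (hbD : Tendsto (fun n => (b n : ℝ) / n) atTop (𝓝 D))
    (hα : Tendsto (fun n : ℕ => (t (b n) : ℝ≥0∞) / n) atTop (𝓝 α)) :
    Tendsto (fun n : ℕ => (t n : ℝ≥0∞) / n) atTop (𝓝 (α / ENNReal.ofReal D)) := by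
  obtain ⟨κ, hκ, hκt⟩ := exists_inverse b hb hb0
  have hbE : Tendsto (fun n : ℕ => (b n : ℝ≥0∞) / n) atTop (𝓝 (ENNReal.ofReal D)) := by
    refine ((ENNReal.continuous_ofReal.tendsto D).comp hbD).congr' ?_
    filter_upwards [eventually_gt_atTop 0] with n hn
    have : (0 : ℝ) < n := by exact_mod_cast hn
    simp only [Function.comp]
    rw [ENNReal.ofReal_div_of_pos this, ENNReal.ofReal_natCast, ENNReal.ofReal_natCast]
  have hratio : Tendsto (fun n : ℕ => ((n : ℝ≥0∞) + 1) / n) atTop (𝓝 1) := by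
    have h1 : Tendsto (fun n : ℕ => (1 : ℝ≥0∞) + (n : ℝ≥0∞)⁻¹) atTop (𝓝 (1 + 0)) :=
      tendsto_const_nhds.add ENNReal.tendsto_inv_nat_nhds_zero
    rw [add_zero] at h1
    refine h1.congr' ?_
    filter_upwards [eventually_gt_atTop 0] with n hn
    have h0 : (n : ℝ≥0∞) ≠ 0 := by exact_mod_cast hn.ne'
    rw [ENNReal.add_div, ENNReal.div_self h0 (ENNReal.natCast_ne_top n), one_div]
  have hD0 : ENNReal.ofReal D ≠ 0 := by simpa using hD
  have hDi0 : (ENNReal.ofReal D)⁻¹ ≠ 0 := by simp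
  have hDit : (ENNReal.ofReal D)⁻¹ ≠ ⊤ := by simpa using hD
  -- `k / b k → 1 / D`
  have hinv : Tendsto (fun n : ℕ => ((b n : ℝ≥0∞) / n)⁻¹) atTop (𝓝 (ENNReal.ofReal D)⁻¹) :=
    ENNReal.tendsto_inv_iff.2 hbE
  have hs : Tendsto (fun n : ℕ => n + 1) atTop atTop := tendsto_add_atTop_nat 1
  -- lower bound
  have hlow : Tendsto (fun k : ℕ => ((t (b k) : ℝ≥0∞) / k) *
      (((b (k + 1) : ℝ≥0∞) / ((k + 1 : ℕ) : ℝ≥0∞))⁻¹ * (((k : ℝ≥0∞) + 1) / k)⁻¹)) atTop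
      (𝓝 (α * ((ENNReal.ofReal D)⁻¹ * 1⁻¹))) := by
    refine ENNReal.Tendsto.mul hα (Or.inr (by simpa using hD)) ?_ (Or.inl (by simp))
    exact ENNReal.Tendsto.mul (hinv.comp hs) (Or.inl hDi0) (ENNReal.tendsto_inv_iff.2 hratio)
      (Or.inl (by simp))
  have hup : Tendsto (fun k : ℕ => ((t (b (k + 1)) : ℝ≥0∞) / ((k + 1 : ℕ) : ℝ≥0∞)) *
      (((b k : ℝ≥0∞) / k)⁻¹ * (((k : ℝ≥0∞) + 1) / k))) atTop
      (𝓝 (α * ((ENNReal.ofReal D)⁻¹ * 1))) := by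
    refine ENNReal.Tendsto.mul (hα.comp hs) (Or.inr (by simpa using hD)) ?_ (Or.inl (by simp))
    exact ENNReal.Tendsto.mul hinv (Or.inl hDi0) hratio (Or.inl (by simp))
  rw [inv_one, mul_one, ← div_eq_mul_inv] at hlow
  rw [mul_one, ← div_eq_mul_inv] at hup
  have hbpos : ∀ k, 0 < k → 0 < b k := fun k hk => by have := hb hk; omega
  refine tendsto_of_tendsto_of_tendsto_of_le_of_le' (hlow.comp hκt) (hup.comp hκt) ?_ ?_
  · filter_upwards [hκt.eventually_gt_atTop 0, eventually_gt_atTop 0] with n hk hn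
    have e1 := hbpos _ hk
    have e2 := hbpos (κ n + 1) (by omega)
    have e3 : t (b (κ n)) ≤ t n := ht.monotone (hκ n).1
    have e4 := (hκ n).2
    simp only [Function.comp]
    have key : ((t (b (κ n)) : ℝ≥0∞) / (κ n)) * (((b (κ n + 1) : ℝ≥0∞) /
        ((κ n + 1 : ℕ) : ℝ≥0∞))⁻¹ * (((κ n : ℝ≥0∞) + 1) / κ n)⁻¹)
        = (t (b (κ n)) : ℝ≥0∞) / b (κ n + 1) := by
      generalize t (b (κ n)) = T at *
      generalize b (κ n + 1) = B at *
      generalize κ n = k at *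
      have hk' : (0 : ℝ) < k := by exact_mod_cast hk
      have hB' : (0 : ℝ) < B := by exact_mod_cast e2
      have : ∀ m : ℕ, (m : ℝ≥0∞) = ENNReal.ofReal m := fun m => (ENNReal.ofReal_natCast m).symm
      have h1 : (k : ℝ≥0∞) + 1 = ENNReal.ofReal ((k : ℝ) + 1) := by
        rw [ENNReal.ofReal_add hk'.le zero_le_one]; simp
      push_cast
      rw [h1, this, this, this, ← ENNReal.ofReal_div_of_pos (by positivity),
        ← ENNReal.ofReal_div_of_pos (by positivity), ← ENNReal.ofReal_div_of_pos (by positivity),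
        ← ENNReal.ofReal_div_of_pos (by positivity), ← ENNReal.ofReal_inv_of_pos (by positivity),
        ← ENNReal.ofReal_inv_of_pos (by positivity), ← ENNReal.ofReal_mul (by positivity),
        ← ENNReal.ofReal_mul (by positivity)]
      congr 1
      field_simp
    rw [key]
    exact ENNReal.div_le_div (by exact_mod_cast e3) (by exact_mod_cast e4.le)
  · filter_upwards [hκt.eventually_gt_atTop 0, eventually_gt_atTop 0] with n hk hn
    have e1 := hbpos _ hk
    have e3 : t n ≤ t (b (κ n + 1)) := ht.monotone (hκ n).2.le
    have e4 := (hκ n).1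
    simp only [Function.comp]
    have key : ((t (b (κ n + 1)) : ℝ≥0∞) / ((κ n + 1 : ℕ) : ℝ≥0∞)) *
        (((b (κ n) : ℝ≥0∞) / κ n)⁻¹ * (((κ n : ℝ≥0∞) + 1) / κ n))
        = (t (b (κ n + 1)) : ℝ≥0∞) / b (κ n) := by
      generalize t (b (κ n + 1)) = T at *
      generalize b (κ n) = B at *
      generalize κ n = k at *
      have hk' : (0 : ℝ) < k := by exact_mod_cast hk
      have hB' : (0 : ℝ) < B := by exact_mod_cast e1
      have : ∀ m : ℕ, (m : ℝ≥0∞) = ENNReal.ofReal m := fun m => (ENNReal.ofReal_natCast m).symm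
      have h1 : (k : ℝ≥0∞) + 1 = ENNReal.ofReal ((k : ℝ) + 1) := by
        rw [ENNReal.ofReal_add hk'.le zero_le_one]; simp
      push_cast
      rw [h1, this, this, this, ← ENNReal.ofReal_div_of_pos (by positivity),
        ← ENNReal.ofReal_div_of_pos (by positivity), ← ENNReal.ofReal_div_of_pos (by positivity),
        ← ENNReal.ofReal_div_of_pos (by positivity), ← ENNReal.ofReal_inv_of_pos (by positivity),
        ← ENNReal.ofReal_mul (by positivity), ← ENNReal.ofReal_mul (by positivity)]
      congr 1
      field_simp
    rw [key]
    exact ENNReal.div_le_div (by exact_mod_cast e3) (by exact_mod_cast e4)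

lemma part_two (f : ℕ → ℤ) (hf : ∀ k, f (k + 1) = f k + 1 ∨ f (k + 1) = f k - 1)
    (hlim : Tendsto f atTop atTop) (t : ℕ → ℕ) (t0 : t 0 = 0) (ht : StrictMono t)
    (h3 : ∀ m : ℕ, f (t m) = m) (h2 : ∀ m k : ℕ, k < t m → f k < m)
    (β : ℝ≥0∞) (hβ : β ≠ 0)
    (hα : Tendsto (fun n : ℕ => (t n : ℝ≥0∞) / n) atTop (𝓝 β)) :
    Tendsto (fun n : ℕ => (f n : ℝ) / n) atTop (𝓝 (β⁻¹).toReal) := by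
  obtain ⟨m, hm, hmt⟩ := exists_inverse t ht t0
  have htpos : ∀ k, 0 < k → 0 < t k := fun k hk => by have := ht hk; omega
  have hr : Tendsto (fun n : ℕ => (n : ℝ) / t n) atTop (𝓝 (β⁻¹).toReal) := by
    have h := (ENNReal.tendsto_toReal (a := β⁻¹) (by simpa using hβ)).comp
      (ENNReal.tendsto_inv_iff.2 hα)
    refine h.congr fun n => ?_
    simp [ENNReal.toReal_div]
  have hupper : ∀ n, (f n : ℝ) ≤ m n := fun n => by
    have := h2 _ _ (hm n).2
    have h' : f n ≤ (m n : ℤ) := by push_cast at this; omega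
    exact_mod_cast h'
  have hup : ∀ᶠ n : ℕ in atTop, (f n : ℝ) / n ≤ (m n : ℝ) / t (m n) := by
    filter_upwards [hmt.eventually_gt_atTop 0] with n hn
    have a := htpos _ hn
    have b := (hm n).1
    have a' : (0 : ℝ) < t (m n) := by exact_mod_cast a
    have b' : (t (m n) : ℝ) ≤ n := by exact_mod_cast b
    exact div_le_div₀ (by positivity) (hupper n) a' b'
  by_cases hβt : β = ⊤
  · subst hβt
    simp only [ENNReal.inv_top, ENNReal.toReal_zero] at hr ⊢
    refine tendsto_of_tendsto_of_tendsto_of_le_of_le' tendsto_const_nhds (hr.comp hmt) ?_ hup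
    filter_upwards [hlim.eventually_ge_atTop 0] with n hn
    have : (0 : ℝ) ≤ f n := by exact_mod_cast hn
    positivity
  · set v := (β⁻¹).toReal with hv
    have hvpos : 0 < v := ENNReal.toReal_pos (by simpa using hβt) (by simpa using hβ)
    have hw : Tendsto (fun n : ℕ => (t n : ℝ) / n) atTop (𝓝 v⁻¹) := by
      refine (hr.inv₀ hvpos.ne').congr fun n => ?_
      rw [inv_div]
    have hs : Tendsto (fun n : ℕ => n + 1) atTop atTop := tendsto_add_atTop_nat 1
    have hn1 : Tendsto (fun n : ℕ => (1 : ℝ) + 1 / n) atTop (𝓝 (1 + 0)) :=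
      tendsto_const_nhds.add tendsto_one_div_atTop_nhds_zero_nat
    have htt : Tendsto (fun n : ℕ => (1 : ℝ) / t n) atTop (𝓝 0) :=
      tendsto_one_div_atTop_nhds_zero_nat.comp ht.tendsto_atTop
    -- lower bound as function of m
    have hlow : Tendsto (fun k : ℕ => (((k + 1 : ℕ) : ℝ) / t (k + 1) - 1 / t (k + 1)) -
        (((t (k + 1) : ℝ) / ((k + 1 : ℕ) : ℝ)) * (1 + 1 / k) * ((k : ℝ) / t k) - 1)) atTop
        (𝓝 ((v - 0) - (v⁻¹ * (1 + 0) * v - 1))) :=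
      ((hr.comp hs).sub (htt.comp hs)).sub
        ((((hw.comp hs).mul hn1).mul hr).sub tendsto_const_nhds)
    have e : (v - 0) - (v⁻¹ * (1 + 0) * v - 1) = v := by field_simp; ring
    rw [e] at hlow
    refine tendsto_of_tendsto_of_tendsto_of_le_of_le' (hlow.comp hmt) (hr.comp hmt) ?_ hup
    filter_upwards [hmt.eventually_gt_atTop 0] with n hn
    have a := htpos _ hn
    have c := htpos (m n + 1) (by omega)
    have b := hm n
    have hback : ∀ j : ℕ, ((m n : ℕ) : ℤ) - j ≤ f (t (m n) + j) := by
      intro j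
      induction j with
      | zero => simp [h3]
      | succ j ih =>
        have := hf (t (m n) + j)
        rw [← add_assoc]
        push_cast
        rcases this with h | h <;> omega
    have hb := hback (n - t (m n))
    rw [Nat.add_sub_cancel' b.1] at hb
    have hb2 : (m n : ℤ) - ((t (m n + 1) : ℤ) - t (m n)) ≤ f n := by omega
    have hb3 : (m n : ℝ) - ((t (m n + 1) : ℝ) - t (m n)) ≤ f n := by exact_mod_cast hb2
    have hA : (0 : ℝ) < t (m n) := by exact_mod_cast a
    have hC : (0 : ℝ) < t (m n + 1) := by exact_mod_cast c
    have hAn : (t (m n) : ℝ) ≤ n := by exact_mod_cast b.1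
    have hnC : (n : ℝ) ≤ t (m n + 1) := by exact_mod_cast b.2.le
    have hk : (0 : ℝ) < m n := by exact_mod_cast hn
    have hN : (0 : ℝ) < n := hA.trans_le hAn
    simp only [Function.comp]
    push_cast
    have e1 : ((m n : ℝ) + 1) / t (m n + 1) - 1 / t (m n + 1) = m n / t (m n + 1) := by ring
    have e2 : (t (m n + 1) : ℝ) / ((m n : ℝ) + 1) * (1 + 1 / m n) * ((m n : ℝ) / t (m n)) - 1
        = ((t (m n + 1) : ℝ) - t (m n)) / t (m n) := by field_simp
    rw [e1, e2]
    calc (m n : ℝ) / t (m n + 1) - ((t (m n + 1) : ℝ) - t (m n)) / t (m n)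
        ≤ (m n : ℝ) / n - ((t (m n + 1) : ℝ) - t (m n)) / n := by
          have hCA : (0 : ℝ) ≤ (t (m n + 1) : ℝ) - t (m n) := by linarith
          gcongr
      _ = ((m n : ℝ) - ((t (m n + 1) : ℝ) - t (m n))) / n := by ring
      _ ≤ (f n : ℝ) / n := by gcongr

/-! ### The quenched walk is nearest-neighbour -/

lemma quenched_nn (env : ℤ → ℝ) (μ : Measure (ℕ → ℤ)) (h : IsQuenchedRW env 0 μ) :
    ∀ᵐ f ∂μ, f 0 = 0 ∧ ∀ k, f (k + 1) = f k + 1 ∨ f (k + 1) = f k - 1 := by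
  obtain ⟨hp, hc⟩ := h
  have h0 : ∀ᵐ f ∂μ, f 0 = 0 := by
    have h1 := hc 0 (fun _ => 0) rfl
    have hms : MeasurableSet {f : ℕ → ℤ | f 0 = 0} :=
      measurableSet_eq_fun (measurable_pi_apply 0) measurable_const
    have hset : {f : ℕ → ℤ | ∀ k ≤ 0, f k = 0} = {f | f 0 = 0} := by
      ext f; simp
    rw [hset] at h1
    exact (mem_ae_iff_prob_eq_one hms).2 (by simpa using h1)
  have hz : ∀ n : ℕ, ∀ q : Fin (n + 2) → ℤ, ∀ᵐ f ∂μ, f 0 = 0 → (∀ i : Fin (n + 2), f i = q i) →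
      (f (n + 1) = f n + 1 ∨ f (n + 1) = f n - 1) := by
    intro n q
    by_cases hq0 : q 0 = 0
    · by_cases hq : q (Fin.last _) = q ⟨n, by omega⟩ + 1 ∨ q (Fin.last _) = q ⟨n, by omega⟩ - 1
      · refine Eventually.of_forall fun f _ hf => ?_
        have e1 := hf (Fin.last _)
        have e2 := hf ⟨n, by omega⟩
        simp only [Fin.val_last] at e1
        simp only at e2
        rw [e1, e2]; exact hq
      · have := hc (n + 1) (fun k => if hk : k < n + 2 then q ⟨k, hk⟩ else 0) (by simpa using hq0)
        have hzero : μ {f : ℕ → ℤ | ∀ k ≤ n + 1,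
            f k = (fun k => if hk : k < n + 2 then q ⟨k, hk⟩ else 0) k} = 0 := by
          rw [this, Finset.prod_eq_zero (i := n) (by simp), ENNReal.ofReal_zero]
          have g1 : n < n + 2 := by omega
          have g2 : n + 1 < n + 2 := by omega
          rw [not_or] at hq
          have hl : (⟨n + 1, g2⟩ : Fin (n + 2)) = Fin.last (n + 1) := rfl
          simp only [stepProb, g1, g2, dif_pos]
          rw [hl, if_neg hq.1, if_neg hq.2]
        have hae := measure_eq_zero_iff_ae_notMem.1 hzero
        filter_upwards [hae] with f hf _ hfq
        exfalso
        apply hf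
        intro k hk
        have hk' : k < n + 2 := by omega
        simp only [hk', dif_pos]
        exact hfq ⟨k, hk'⟩
    · refine Eventually.of_forall fun f hf0 hf => ?_
      exact absurd ((hf 0).symm.trans (by simpa using hf0)) hq0
  have hz' : ∀ᵐ f ∂μ, ∀ n : ℕ, ∀ q : Fin (n + 2) → ℤ, f 0 = 0 → (∀ i : Fin (n + 2), f i = q i) →
      (f (n + 1) = f n + 1 ∨ f (n + 1) = f n - 1) :=
    ae_all_iff.2 fun n => ae_all_iff.2 (hz n)
  filter_upwards [h0, hz'] with f hf0 hf
  exact ⟨hf0, fun k => hf k (fun i => f i) hf0 fun _ => rfl⟩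

lemma iterate_shift (k : ℕ) (f : ℤ → ℝ × ℕ) (n : ℤ) :
    ((fun f : ℤ → ℝ × ℕ => fun n => f (n + 1))^[k] f) n = f (n + k) := by
  induction k generalizing f n with
  | zero => simp
  | succ k ih =>
    rw [Function.iterate_succ_apply, ih]
    congr 1
    push_cast; ring

/-- Lemma `teax-lemma`: if `T_{a_n}/n → α ∈ (0,∞]` ℙ-a.s., then
`T_n/n → α/E_P(d_1)` and `X_n/n → E_P(d_1)/α` ℙ-a.s. -/
theorem statement15
    {Ω : Type*} [MeasurableSpace Ω] (P : Measure Ω) [IsProbabilityMeasure P]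
    (lam : ℤ → Ω → ℝ) (d : ℤ → Ω → ℕ) (a : ℤ → Ω → ℤ)
    (hlam_meas : ∀ k, Measurable (lam k)) (hd_meas : ∀ k, Measurable (d k))
    (hlam01 : ∀ k, ∀ᵐ ω ∂P, lam k ω ∈ Set.Ioo (0 : ℝ) 1)
    (hd_pos : ∀ k ω, 1 ≤ d k ω)
    (ha0 : ∀ ω, a 0 ω = 0)
    (ha_rec : ∀ ω, ∀ k : ℤ, a k ω - a (k - 1) ω = d k ω)
    -- stationarity and ergodicity of `(d_n, λ_n)` under `P`
    (h_erg : Ergodic (fun f : ℤ → ℝ × ℕ => fun n => f (n + 1))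
      (P.map fun ω => fun n : ℤ => (lam n ω, d n ω)))
    -- `E_P (log ξ_0)` exists in `[-∞, ∞]`
    (hexists :
      (∫⁻ ω, ENNReal.ofReal (Real.log ((1 - lam 0 ω) / lam 0 ω)) ∂P ≠ ⊤) ∨
      (∫⁻ ω, ENNReal.ofReal (-Real.log ((1 - lam 0 ω) / lam 0 ω)) ∂P ≠ ⊤))
    -- `E_P (log d_0) < ∞`
    (hlogd : ∫⁻ ω, ENNReal.ofReal (Real.log (d 0 ω)) ∂P ≠ ⊤)
    -- `E_P (d_1) < ∞`
    (hd_int : ∫⁻ ω, (d 1 ω : ℝ≥0∞) ∂P ≠ ⊤)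
    -- quenched law and annealed law
    (K : Kernel Ω (ℕ → ℤ)) [IsMarkovKernel K]
    (hK : ∀ ω, IsQuenchedRW (sparseEnv (fun k => lam k ω) (fun k => a k ω)) 0 (K ω))
    -- the walk is transient to the right
    (h_trans : ∀ᵐ p ∂(P ⊗ₘ K), Tendsto (fun n => p.2 n) atTop atTop)
    -- `T_{a_n}/n → α` ℙ-a.s. for some constant `α ∈ (0, ∞]`
    (α : ℝ≥0∞) (hα : 0 < α)
    (hTa : ∀ᵐ p ∂(P ⊗ₘ K),
      Tendsto (fun n : ℕ => hitTime p.2 (a (n : ℤ) p.1) / (n : ℝ≥0∞)) atTop (𝓝 α)) :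
    -- `T_n/n → α / E_P(d_1)` ℙ-a.s.
    (∀ᵐ p ∂(P ⊗ₘ K),
      Tendsto (fun n : ℕ => hitTime p.2 (n : ℤ) / (n : ℝ≥0∞)) atTop
        (𝓝 (α / ∫⁻ ω, (d 1 ω : ℝ≥0∞) ∂P))) ∧
    -- `X_n/n → E_P(d_1) / α` ℙ-a.s.
    (∀ᵐ p ∂(P ⊗ₘ K),
      Tendsto (fun n : ℕ => (p.2 n : ℝ) / (n : ℝ)) atTop
        (𝓝 (((∫⁻ ω, (d 1 ω : ℝ≥0∞) ∂P) / α).toReal))) := by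
  have hΦ : Measurable fun ω => fun n : ℤ => (lam n ω, d n ω) :=
    measurable_pi_lambda _ fun n => (hlam_meas n).prodMk (hd_meas n)
  have hdm : ∀ k, Measurable fun ω => (d k ω : ℝ) := fun k =>
    (measurable_of_countable (fun n : ℕ => (n : ℝ))).comp (hd_meas k)
  set D : ℝ := ∫ ω, (d 1 ω : ℝ) ∂P with hDdef
  have hlint : ∫⁻ ω, ENNReal.ofReal (d 1 ω : ℝ) ∂P = ∫⁻ ω, (d 1 ω : ℝ≥0∞) ∂P := by
    simp only [ENNReal.ofReal_natCast]
  have hint : Integrable (fun ω => (d 1 ω : ℝ)) P := by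
    refine ⟨(hdm 1).aestronglyMeasurable, ?_⟩
    rw [hasFiniteIntegral_iff_ofReal (Eventually.of_forall fun ω => Nat.cast_nonneg _), hlint]
    exact lt_top_iff_ne_top.2 hd_int
  have hDE : ∫⁻ ω, (d 1 ω : ℝ≥0∞) ∂P = ENNReal.ofReal D := by
    rw [hDdef, ofReal_integral_eq_lintegral_ofReal hint
      (Eventually.of_forall fun ω => Nat.cast_nonneg _), hlint]
  have hDpos : 0 < D := by
    have : ∫ _ω, (1 : ℝ) ∂P ≤ D := integral_mono (integrable_const _) hint fun ω => by
      simpa using hd_pos 1 ω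
    simp at this
    linarith
  -- natural-valued positions of marked sites
  let b : Ω → ℕ → ℕ := fun ω n => ∑ k ∈ Finset.range n, d (1 + k) ω
  have hab : ∀ ω (n : ℕ), a n ω = (b ω n : ℤ) := by
    intro ω n
    induction n with
    | zero => simpa [b] using ha0 ω
    | succ n ih =>
      have h1 := ha_rec ω (n + 1)
      rw [add_sub_cancel_right, ih] at h1
      have h2 : b ω (n + 1) = b ω n + d (1 + n) ω := Finset.sum_range_succ _ _
      rw [h2, add_comm (1 : ℤ)]
      push_cast
      linarith
  have hbmono : ∀ ω, StrictMono (b ω) := fun ω => strictMono_nat_of_lt_succ fun n => by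
    have h2 : b ω (n + 1) = b ω n + d (1 + n) ω := Finset.sum_range_succ _ _
    have := hd_pos (1 + n) ω
    omega
  -- ergodic theorem
  have hbirk : ∀ᵐ ω ∂P, Tendsto (fun n : ℕ => (b ω n : ℝ) / n) atTop (𝓝 D) := by
    haveI : IsProbabilityMeasure (P.map fun ω => fun n : ℤ => (lam n ω, d n ω)) :=
      Measure.isProbabilityMeasure_map hΦ.aemeasurable
    have hg : Measurable fun f : ℤ → ℝ × ℕ => ((f 1).2 : ℝ) :=
      (measurable_of_countable (fun n : ℕ => (n : ℝ))).comp
        (measurable_snd.comp (measurable_pi_apply 1))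
    have hgi : Integrable (fun f : ℤ → ℝ × ℕ => ((f 1).2 : ℝ))
        (P.map fun ω => fun n : ℤ => (lam n ω, d n ω)) :=
      (integrable_map_measure hg.aestronglyMeasurable hΦ.aemeasurable).2 hint
    have h := ae_of_ae_map hΦ.aemeasurable (birkhoff_tendsto h_erg hg hgi)
    rw [integral_map hΦ.aemeasurable hg.aestronglyMeasurable] at h
    filter_upwards [h] with ω hω
    refine hω.congr fun n => ?_
    simp only [birkhoffSum, iterate_shift, b]
    push_cast
    rfl
  have hbirk' : ∀ᵐ p ∂(P ⊗ₘ K), Tendsto (fun n : ℕ => (b p.1 n : ℝ) / n) atTop (𝓝 D) := by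
    refine Measure.ae_compProd_of_ae_fst K (p := fun ω =>
      Tendsto (fun n : ℕ => (b ω n : ℝ) / n) atTop (𝓝 D)) ?_ hbirk
    refine measurableSet_tendsto _ fun n => ?_
    refine Measurable.div_const ?_ _
    simp only [b]
    push_cast
    exact Finset.measurable_sum _ fun i _ => hdm _
  have hnn : ∀ᵐ p ∂(P ⊗ₘ K), p.2 0 = 0 ∧
      ∀ k, p.2 (k + 1) = p.2 k + 1 ∨ p.2 (k + 1) = p.2 k - 1 := by
    refine Measure.ae_compProd_of_ae_ae ?_ (Eventually.of_forall fun ω => quenched_nn _ _ (hK ω))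
    have hc : ∀ k, Measurable fun p : Ω × (ℕ → ℤ) => p.2 k := fun k =>
      (measurable_pi_apply k).comp measurable_snd
    have : {p : Ω × (ℕ → ℤ) | p.2 0 = 0 ∧
        ∀ k, p.2 (k + 1) = p.2 k + 1 ∨ p.2 (k + 1) = p.2 k - 1} =
        {p | p.2 0 = 0} ∩ ⋂ k, ({p | p.2 (k + 1) = p.2 k + 1} ∪ {p | p.2 (k + 1) = p.2 k - 1}) := by
      ext p; simp
    rw [this]
    exact (measurableSet_eq_fun (hc 0) measurable_const).inter (MeasurableSet.iInter fun k =>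
      (measurableSet_eq_fun (hc _) ((hc k).add_const 1)).union
        (measurableSet_eq_fun (hc _) ((hc k).sub_const 1)))
  rw [hDE]
  have hmain : ∀ᵐ p ∂(P ⊗ₘ K),
      Tendsto (fun n : ℕ => hitTime p.2 (n : ℤ) / (n : ℝ≥0∞)) atTop
        (𝓝 (α / ENNReal.ofReal D)) ∧
      Tendsto (fun n : ℕ => (p.2 n : ℝ) / (n : ℝ)) atTop
        (𝓝 ((ENNReal.ofReal D / α).toReal)) := by
    filter_upwards [hbirk', hnn, h_trans, hTa] with p hb hn htr hT
    obtain ⟨t, t0, ht, hit, h3, h2⟩ := exists_hit p.2 hn.1 hn.2 htr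
    have hT' : Tendsto (fun n : ℕ => (t (b p.1 n) : ℝ≥0∞) / n) atTop (𝓝 α) := by
      refine hT.congr fun n => ?_
      rw [hab, hit]
    have h1 := part_one t (b p.1) ht (hbmono p.1) (by simp [b]) D hDpos α hb hT'
    refine ⟨by simpa only [hit] using h1, ?_⟩
    have h4 := part_two p.2 hn.2 htr t t0 ht h3 h2 (α / ENNReal.ofReal D)
      (ENNReal.div_ne_zero.2 ⟨hα.ne', ENNReal.ofReal_ne_top⟩) h1
    rwa [ENNReal.inv_div (Or.inl ENNReal.ofReal_ne_top) (Or.inr hα.ne')] at h4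
  exact ⟨hmain.mono fun p h => h.1, hmain.mono fun p h => h.2⟩
end
end
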